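/- Let 0 < R < T and let w be a C² function of (x,t) on an open neighborhood of K = {(x,t) : R ≤ |x| ≤ (R+T)/2, |x| ≤ t ≤ R+T−|x|}. Set F = ∂_t²w − ∂_r∂_r w − |x|^{-2} Ω w, w̄(x) = w(x,|x|), w̿(x) = w(x, R+T−|x|), A = {x : R ≤ |x| ≤ (R+T)/2}, C = {(x,t) : |x| = R, R ≤ t ≤ T}, and K^s = K ∩ {(x,t) : R ≤ t ≤ s}. For s ∈ [R,T] define the energy E(s) = ∫_{A^s} |x|^{-2} ( w² + (∂_t w)² + |∇w|² )(x,s) dx, where A^s = {x : R ≤ |x| ≤ min(s, R+T−s)} and ∇ is the spatial gradient, plus, when s ≥ (R+T)/2, the additional term ∫_{R+T−s ≤ |x| ≤ (R+T)/2} |x|^{-2} ( w̿² + |∇w̿|² ) dx. Then for every s ∈ [R,T]: E(s) ≤ ∫_A |x|^{-2} ( w̄² + |∇w̄|² ) dx + 2 ∫_{K^s} |x|^{-2} (∂_t w)(F + w) dx dt + ∫_R^T ∫_{S_R} R^{-2} ( (∂_t w)² + (∂_r w)² ) dσ dt. -/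

import Mathlib

noncomputable section

open Real MeasureTheory Metric Set

/-- Euclidean 3-space. -/
abbrev E3 : Type := EuclideanSpace ℝ (Fin 3)

/-- The `i`-th standard basis vector of `ℝ³`. -/
def basis3 (i : Fin 3) : E3 := EuclideanSpace.single i 1

/-- The partial derivative `∂ᵢ f` of a function on `ℝ³`. -/
def pd (i : Fin 3) (f : E3 → ℝ) (x : E3) : ℝ := fderiv ℝ f x (basis3 i)

/-- The Laplacian `Δf` on `ℝ³`. -/
def lap (f : E3 → ℝ) (x : E3) : ℝ := ∑ i, pd i (pd i f) x

/-- The radial derivative `∂_r f(x) = (x/|x|)·∇f(x)`. -/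
def pdr (f : E3 → ℝ) (x : E3) : ℝ := ‖x‖⁻¹ * ∑ i, x i * pd i f x

/-- The angular derivative `Ω_{ij} f = xᵢ ∂ⱼ f − xⱼ ∂ᵢ f`. -/
def ang (i j : Fin 3) (f : E3 → ℝ) (x : E3) : ℝ := x i * pd j f x - x j * pd i f x

/-- `Ω f = Σ_{i<j} Ω_{ij}(Ω_{ij} f)`. -/
def angLap (f : E3 → ℝ) (x : E3) : ℝ :=
  ∑ i, ∑ j, if i < j then ang i j (ang i j f) x else 0

/-- The squared length `|∇f(x)|²` of the gradient. -/
def gradsq (f : E3 → ℝ) (x : E3) : ℝ := ∑ i, (pd i f x) ^ 2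

/-- `Σ_{i<j} (Ω_{ij} g)²`. -/
def angsq (g : E3 → ℝ) (x : E3) : ℝ := ∑ i, ∑ j, if i < j then (ang i j g x) ^ 2 else 0

/-- `Σ_{i<j} Σ_{k<l} (Ω_{kl} Ω_{ij} g)²`. -/
def angsq2 (g : E3 → ℝ) (x : E3) : ℝ :=
  ∑ i, ∑ j, ∑ k, ∑ l, if i < j ∧ k < l then (ang k l (ang i j g) x) ^ 2 else 0

/-- The time derivative `∂_t u` of a space-time function. -/
def pdt (u : E3 × ℝ → ℝ) (p : E3 × ℝ) : ℝ := fderiv ℝ u p (0, 1)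

/-- The spatial slice `x ↦ u(x,t)` of a space-time function, at fixed time `t`. -/
def fixT (u : E3 × ℝ → ℝ) (t : ℝ) : E3 → ℝ := fun y => u (y, t)

/-- The spatial partial derivative `∂ᵢ u` of a space-time function (`t` fixed). -/
def pdx (i : Fin 3) (u : E3 × ℝ → ℝ) (p : E3 × ℝ) : ℝ := pd i (fixT u p.2) p.1

/-- The spatial radial derivative `∂_r u` of a space-time function (`t` fixed). -/
def pdrX (u : E3 × ℝ → ℝ) (p : E3 × ℝ) : ℝ := pdr (fixT u p.2) p.1

/-- The spatial angular derivative `Ω_{ij} u` of a space-time function (`t` fixed). -/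
def angX (i j : Fin 3) (u : E3 × ℝ → ℝ) (p : E3 × ℝ) : ℝ := ang i j (fixT u p.2) p.1

/-- The spatial operator `Ω u` of a space-time function (`t` fixed). -/
def angLapX (u : E3 × ℝ → ℝ) (p : E3 × ℝ) : ℝ := angLap (fixT u p.2) p.1

/-- The spatial Laplacian `Δu` of a space-time function (`t` fixed). -/
def lapX (u : E3 × ℝ → ℝ) (p : E3 × ℝ) : ℝ := lap (fixT u p.2) p.1

/-- The squared spatial gradient `|∇u|²` of a space-time function (`t` fixed). -/
def gradsqX (u : E3 × ℝ → ℝ) (p : E3 × ℝ) : ℝ := gradsq (fixT u p.2) p.1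

/-- `Σ_{i<j} (Ω_{ij} w)²` for a space-time function (`t` fixed). -/
def angsqX (w : E3 × ℝ → ℝ) (p : E3 × ℝ) : ℝ :=
  ∑ i, ∑ j, if i < j then (angX i j w p) ^ 2 else 0

/-- The solid light cone `t ≥ |x|`. -/
def cone : Set (E3 × ℝ) := {p | ‖p.1‖ ≤ p.2}

/-- `u` is a C² solution of the Goursat problem for `q` on the cone `t ≥ |x|`:
`∂_t²u − Δu − q u = 0` for `t > |x|` and `u(x,|x|) = ∫₀¹ q(σx) dσ`. -/
def GoursatSol (q : E3 → ℝ) (u : E3 × ℝ → ℝ) : Prop :=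
  ContDiffOn ℝ 2 u cone ∧
  (∀ p : E3 × ℝ, ‖p.1‖ < p.2 → pdt (pdt u) p - lapX u p - q p.1 * u p = 0) ∧
  (∀ x : E3, u (x, ‖x‖) = ∫ σ in (0:ℝ)..1, q (σ • x))

/-- `p(x) = ∫₀^{|x|} q(σ x/|x|) dσ`. -/
def pfun (q : E3 → ℝ) (x : E3) : ℝ := ∫ σ in (0:ℝ)..‖x‖, q ((σ / ‖x‖) • x)

/-- Integral over the sphere of radius `r` with respect to surface measure. -/
def sphInt (r : ℝ) (g : E3 → ℝ) : ℝ := ∫ x in sphere (0:E3) r, g x ∂μH[2]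

/-- Squared `L²` norm on the sphere of radius `r`. -/
def L2sq (g : E3 → ℝ) (r : ℝ) : ℝ := sphInt r (fun x => (g x) ^ 2)

/-- Squared `H¹` norm on the sphere of radius `r`. -/
def H1sq (g : E3 → ℝ) (r : ℝ) : ℝ := sphInt r (fun x => (g x) ^ 2 + (r ^ 2)⁻¹ * angsq g x)

/-- Squared `H²` norm on the sphere of radius `r`. -/
def H2sq (g : E3 → ℝ) (r : ℝ) : ℝ := H1sq g r + sphInt r (fun x => (r ^ 4)⁻¹ * angsq2 g x)

/-- The class `Q_γ(R,T)`. -/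
def memQ (R T γ : ℝ) (q : E3 → ℝ) : Prop :=
  ∀ r ∈ Icc R ((R + T) / 2),
    Real.sqrt (H2sq (pfun q) r) + Real.sqrt (H1sq (pdr (pfun q)) r) ≤
      γ * (Real.sqrt (H1sq (pfun q) r) + Real.sqrt (L2sq (pdr (pfun q)) r))

/-- The closed annulus `R ≤ |x| ≤ ρ` in `ℝ³`. -/
def Ann (R ρ : ℝ) : Set E3 := {x | R ≤ ‖x‖ ∧ ‖x‖ ≤ ρ}

/-- The space-time region `K_ρ = {R ≤ |x| ≤ ρ, |x| ≤ t ≤ R+T−|x|}`. -/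
def Kreg (R T ρ : ℝ) : Set (E3 × ℝ) :=
  {p | R ≤ ‖p.1‖ ∧ ‖p.1‖ ≤ ρ ∧ ‖p.1‖ ≤ p.2 ∧ p.2 ≤ R + T - ‖p.1‖}

/-- `F = ∂_t²w − ∂_r∂_r w − |x|^{-2} Ω w`. -/
def Fop (w : E3 × ℝ → ℝ) (p : E3 × ℝ) : ℝ :=
  pdt (pdt w) p - pdrX (pdrX w) p - (‖p.1‖ ^ 2)⁻¹ * angLapX w p

/-- The sideways energy `J(ρ)`. -/
def Jfun (R T : ℝ) (w : E3 × ℝ → ℝ) (ρ : ℝ) : ℝ :=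
  ∫ t in ρ..(R + T - ρ), sphInt ρ
    (fun x => (ρ ^ 2)⁻¹ * ((w (x, t)) ^ 2 + (pdt w (x, t)) ^ 2 + gradsqX w (x, t)))

open scoped ENNReal

/-- Surface measure on the unit sphere of `ℝ³`. -/
abbrev unitSurf : Measure (sphere (0 : E3) 1) := (volume : Measure E3).toSphere

/-- The measure `r² dr` on the positive half-line. -/
def radialMeasure : Measure ℝ :=
  (volume.restrict (Ioi (0 : ℝ))).withDensity fun r => ENNReal.ofReal (r ^ 2)

lemma map_val_volumeIoiPow :
    (Measure.volumeIoiPow 2).map (Subtype.val : Ioi (0 : ℝ) → ℝ) = radialMeasure := by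
  ext s hs
  rw [Measure.map_apply measurable_subtype_coe hs, Measure.volumeIoiPow,
    withDensity_apply _ (measurable_subtype_coe hs), radialMeasure, withDensity_apply _ hs,
    setLIntegral_subtype measurableSet_Ioi _ fun a : ℝ => ENNReal.ofReal (a ^ 2),
    Measure.restrict_restrict hs, Subtype.image_preimage_coe, inter_comm]

instance : SFinite radialMeasure := by
  rw [← map_val_volumeIoiPow]; infer_instance

lemma measurePreserving_polar :
    MeasurePreserving (fun p : sphere (0 : E3) 1 × ℝ => p.2 • (p.1 : E3))
      (unitSurf.prod radialMeasure) volume := by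
  have hm : Measurable (fun p : sphere (0 : E3) 1 × ℝ => p.2 • (p.1 : E3)) :=
    (by fun_prop : Continuous _).measurable
  refine ⟨hm, ?_⟩
  have h := (Measure.measurePreserving_homeomorphUnitSphereProd (volume : Measure E3))
  have hfin : Module.finrank ℝ E3 - 1 = 2 := by simp
  rw [hfin] at h
  have h2 := (MeasurePreserving.symm (homeomorphUnitSphereProd E3).toMeasurableEquiv h).map_eq
  have h3 : (volume : Measure E3) =
      (Measure.comap (Subtype.val : ({0}ᶜ : Set E3) → E3) volume).map Subtype.val := by
    rw [map_comap_subtype_coe (measurableSet_singleton _).compl,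
      Measure.restrict_eq_self_of_ae_mem]
    exact compl_mem_ae_iff.2 (by simp)
  rw [← map_val_volumeIoiPow]
  have h4 : unitSurf.prod ((Measure.volumeIoiPow 2).map (Subtype.val : Ioi (0 : ℝ) → ℝ)) =
      (unitSurf.prod (Measure.volumeIoiPow 2)).map (Prod.map id Subtype.val) := by
    rw [← Measure.map_prod_map _ _ measurable_id measurable_subtype_coe, Measure.map_id]
  rw [h4, Measure.map_map hm (by fun_prop), h3, ← h2,
    Measure.map_map measurable_subtype_coe (MeasurableEquiv.measurable _)]
  rfl

lemma measurableSet_Ann (a b : ℝ) : MeasurableSet (Ann a b) :=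
  ((isClosed_le continuous_const continuous_norm).inter
    (isClosed_le continuous_norm continuous_const)).measurableSet

lemma isCompact_Ann (a b : ℝ) : IsCompact (Ann a b) := by
  refine (isCompact_closedBall (0 : E3) b).of_isClosed_subset
    ((isClosed_le continuous_const continuous_norm).inter
    (isClosed_le continuous_norm continuous_const)) fun x hx => ?_
  simpa using hx.2

lemma norm_smul_sphere (n : sphere (0 : E3) 1) {r : ℝ} (hr : 0 ≤ r) : ‖r • (n : E3)‖ = r := by
  rw [norm_smul, norm_eq_of_mem_sphere, mul_one, Real.norm_of_nonneg hr]

lemma integral_radialMeasure (f : ℝ → ℝ) :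
    ∫ r, f r ∂radialMeasure = ∫ r in Ioi (0 : ℝ), r ^ 2 * f r := by
  rw [radialMeasure, integral_withDensity_eq_integral_toReal_smul (by fun_prop) (by simp)]
  refine integral_congr_ae (Filter.Eventually.of_forall fun r => ?_)
  simp [ENNReal.toReal_ofReal (sq_nonneg r)]

lemma integrable_ann {a b : ℝ} (ha : 0 < a) {h : E3 → ℝ} (hh : ContinuousOn h (Ann a b)) :
    IntegrableOn (fun x => (‖x‖ ^ 2)⁻¹ * h x) (Ann a b) := by
  refine ContinuousOn.integrableOn_compact (isCompact_Ann a b) ?_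
  refine ContinuousOn.mul (ContinuousOn.inv₀ (by fun_prop) fun x hx => ?_) hh
  have := ha.trans_le hx.1
  positivity

lemma indicator_ann_polar {a b : ℝ} (h : E3 → ℝ) (n : sphere (0 : E3) 1) {r : ℝ}
    (hr : 0 < r) :
    r ^ 2 * (Ann a b).indicator (fun x => (‖x‖ ^ 2)⁻¹ * h x) (r • (n : E3)) =
      (Icc a b).indicator (fun r => h (r • (n : E3))) r := by
  have h1 : r • (n : E3) ∈ Ann a b ↔ r ∈ Icc a b := by
    simp only [Ann, mem_ofPred_eq, norm_smul_sphere n hr.le, mem_Icc]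
  by_cases hm : r ∈ Icc a b
  · rw [indicator_of_mem (h1.2 hm), indicator_of_mem hm, norm_smul_sphere n hr.le]
    field_simp
  · rw [indicator_of_notMem (fun h => hm (h1.1 h)), indicator_of_notMem hm, mul_zero]

lemma integral_ann {a b : ℝ} (ha : 0 < a) (hab : a ≤ b) {h : E3 → ℝ}
    (hh : ContinuousOn h (Ann a b)) :
    ∫ x in Ann a b, (‖x‖ ^ 2)⁻¹ * h x =
      ∫ n : sphere (0 : E3) 1, (∫ r in a..b, h (r • (n : E3))) ∂unitSurf := by
  have hfi := (integrable_indicator_iff (measurableSet_Ann a b)).2 (integrable_ann ha hh)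
  have hcomp := (measurePreserving_polar.integrable_comp hfi.aestronglyMeasurable).2 hfi
  simp only [Function.comp_def] at hcomp
  rw [← integral_indicator (measurableSet_Ann a b), ← measurePreserving_polar.map_eq,
    integral_map measurePreserving_polar.aemeasurable
      (by rw [measurePreserving_polar.map_eq]; exact hfi.aestronglyMeasurable),
    integral_prod _ hcomp]
  refine integral_congr_ae (Filter.Eventually.of_forall fun n => ?_)
  simp only
  rw [integral_radialMeasure, intervalIntegral.integral_of_le hab, ← integral_Icc_eq_integral_Ioc,
    ← integral_indicator measurableSet_Icc,
    setIntegral_congr_fun measurableSet_Ioi fun r hr => indicator_ann_polar h n hr,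
    setIntegral_eq_integral_of_forall_compl_eq_zero]
  intro r hr
  refine indicator_of_notMem (fun hm => hr (ha.trans_le hm.1)) _

lemma integral_ann' {a b : ℝ} (ha : 0 < a) (hab : a ≤ b) {h : E3 → ℝ}
    (hh : ContinuousOn h (Ann a b)) :
    ∫ x in Ann a b, (‖x‖ ^ 2)⁻¹ * h x =
      ∫ r in a..b, (∫ n : sphere (0 : E3) 1, h (r • (n : E3)) ∂unitSurf) := by
  have hfi := (integrable_indicator_iff (measurableSet_Ann a b)).2 (integrable_ann ha hh)
  have hcomp := (measurePreserving_polar.integrable_comp hfi.aestronglyMeasurable).2 hfi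
  simp only [Function.comp_def] at hcomp
  rw [← integral_indicator (measurableSet_Ann a b), ← measurePreserving_polar.map_eq,
    integral_map measurePreserving_polar.aemeasurable
      (by rw [measurePreserving_polar.map_eq]; exact hfi.aestronglyMeasurable),
    integral_prod_symm _ hcomp]
  rw [integral_radialMeasure, intervalIntegral.integral_of_le hab, ← integral_Icc_eq_integral_Ioc,
    ← integral_indicator measurableSet_Icc]
  rw [setIntegral_congr_fun (g := (Icc a b).indicator
      fun r => ∫ n : sphere (0 : E3) 1, h (r • (n : E3)) ∂unitSurf) measurableSet_Ioi fun r hr => ?_,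
    setIntegral_eq_integral_of_forall_compl_eq_zero]
  · intro r hr
    exact indicator_of_notMem (fun hm => hr (ha.trans_le hm.1)) _
  · simp only
    rw [← integral_const_mul]
    simp_rw [indicator_ann_polar h _ hr]
    by_cases hm : r ∈ Icc a b
    · simp [hm]
    · simp [hm]

lemma volume_orthonormal_box (b : OrthonormalBasis (Fin 3) ℝ E3) (l u : Fin 3 → ℝ) :
    volume {x : E3 | ∀ i, b.repr x i ∈ Icc (l i) (u i)} = ∏ i, ENNReal.ofReal (u i - l i) := by
  have h : MeasurePreserving (fun x : E3 => WithLp.ofLp (b.repr x)) :=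
    (PiLp.volume_preserving_ofLp (Fin 3)).comp b.measurePreserving_repr
  rw [← Real.volume_Icc_pi, ← h.measure_preimage measurableSet_Icc.nullMeasurableSet]
  congr 1
  ext x
  simp only [mem_ofPred_eq, mem_preimage, mem_Icc, Pi.le_def]
  exact forall_and

lemma exists_orthonormalBasis_fst {e : E3} (he : ‖e‖ = 1) :
    ∃ b : OrthonormalBasis (Fin 3) ℝ E3, b 0 = e := by
  have h : Orthonormal ℝ (({0} : Set (Fin 3)).domRestrict fun _ => e) := by
    refine ⟨fun _ => he, fun i j hij => ?_⟩
    exact absurd (Subsingleton.elim i j) hij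
  obtain ⟨b, hb⟩ := h.exists_orthonormalBasis_extension_of_card_eq (by simp)
  exact ⟨b, hb 0 rfl⟩

lemma ofReal_le_radialMeasure {h : ℝ} :
    ENNReal.ofReal h ≤ radialMeasure (Ioo 1 (1 + h)) := by
  have hsub : Ioo 1 (1 + h) ⊆ Ioi 0 := fun r hr => zero_lt_one.trans hr.1
  rw [radialMeasure, withDensity_apply _ measurableSet_Ioo,
    Measure.restrict_restrict measurableSet_Ioo, inter_eq_left.2 hsub]
  calc ENNReal.ofReal h = ∫⁻ _ in Ioo 1 (1 + h), 1 := by simp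
    _ ≤ _ := by
      refine setLIntegral_mono (by fun_prop) fun r hr => ?_
      rw [← ENNReal.ofReal_one]
      exact ENNReal.ofReal_le_ofReal (by nlinarith [hr.1])

lemma unitSurf_mul_le_volume {B : Set (sphere (0 : E3) 1)} {h : ℝ} {Q : Set E3}
    (hQm : MeasurableSet Q)
    (hQ : ∀ n ∈ B, ∀ r ∈ Ioo 1 (1 + h), r • (n : E3) ∈ Q) :
    unitSurf B * ENNReal.ofReal h ≤ volume Q := by
  rw [← measurePreserving_polar.measure_preimage hQm.nullMeasurableSet]
  calc unitSurf B * ENNReal.ofReal h ≤ unitSurf B * radialMeasure (Ioo 1 (1 + h)) := by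
        gcongr; exact ofReal_le_radialMeasure
    _ = unitSurf.prod radialMeasure (B ×ˢ Ioo 1 (1 + h)) := (Measure.prod_prod _ _).symm
    _ ≤ _ := measure_mono fun p hp => hQ p.1 hp.1 p.2 hp.2

lemma unitSurf_mul_le_of_dist_le {B : Set (sphere (0 : E3) 1)} (hB : IsClosed B) {d h : ℝ}
    (hd0 : 0 ≤ d) (hd : d ≤ 1) (hdist : ∀ n ∈ B, ∀ m ∈ B, dist n m ≤ d) :
    unitSurf B * ENNReal.ofReal h ≤ ENNReal.ofReal ((d * (1 + 2 * h)) ^ 2 * (h + d ^ 2)) := by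
  rcases le_or_gt h 0 with hh | hh
  · simp [ENNReal.ofReal_of_nonpos hh]
  rcases B.eq_empty_or_nonempty with rfl | ⟨e, he⟩
  · simp
  obtain ⟨b, hb⟩ := exists_orthonormalBasis_fst (norm_eq_of_mem_sphere e)
  have hmin : ∀ i, ∃ m ∈ B, ∀ n ∈ B, b.repr (m : E3) i ≤ b.repr (n : E3) i := by
    intro i
    exact hB.isCompact.exists_isMinOn ⟨e, he⟩
      (by fun_prop : Continuous fun n : sphere (0 : E3) 1 => b.repr (n : E3) i).continuousOn
  choose m hmB hm using hmin
  set c : Fin 3 → ℝ := fun i => b.repr (m i : E3) i with hc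
  have hcoord : ∀ (x y : sphere (0 : E3) 1) i, x ∈ B → y ∈ B →
      |b.repr (x : E3) i - b.repr (y : E3) i| ≤ d := by
    intro x y i hx hy
    have h1 : b.repr (x : E3) i - b.repr (y : E3) i = b.repr ((x : E3) - y) i := by simp
    have h2 : ‖b.repr ((x : E3) - y) i‖ ≤ ‖b.repr ((x : E3) - y)‖ := PiLp.norm_apply_le _ i
    rw [h1, ← Real.norm_eq_abs]
    refine h2.trans ?_
    rw [b.repr.norm_map, ← dist_eq_norm]
    exact hdist x hx y hy
  have hrepr0 : b.repr (e : E3) 0 = 1 := by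
    rw [b.repr_apply_apply, hb, real_inner_self_eq_norm_sq, norm_eq_of_mem_sphere]; norm_num
  have hrepri : ∀ i, i ≠ 0 → b.repr (e : E3) i = 0 := by
    intro i hi
    rw [b.repr_apply_apply, ← hb]
    exact b.orthonormal.2 hi
  set l : Fin 3 → ℝ := ![1 - d ^ 2, c 1 - h * d, c 2 - h * d] with hl
  set u : Fin 3 → ℝ := ![1 + h, c 1 + d + h * d, c 2 + d + h * d] with hu
  have hQm : MeasurableSet {x : E3 | ∀ i, b.repr x i ∈ Icc (l i) (u i)} := by
    have : {x : E3 | ∀ i, b.repr x i ∈ Icc (l i) (u i)} =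
        ⋂ i, (fun x : E3 => b.repr x i) ⁻¹' Icc (l i) (u i) := by ext; simp
    rw [this]
    exact MeasurableSet.iInter fun i =>
      (isClosed_Icc.preimage (by fun_prop)).measurableSet
  refine (unitSurf_mul_le_volume (h := h) hQm ?_).trans ?_
  · intro n hn r hr
    have hr1 := hr.1
    have hr2 := hr.2
    have hlat : ∀ i, i ≠ 0 → b.repr (r • (n : E3)) i ∈ Icc (c i - h * d) (c i + d + h * d) := by
      intro i hi
      have h1 : b.repr (r • (n : E3)) i = r * b.repr (n : E3) i := by simp
      have h2 := abs_le.1 (hcoord n e i hn he)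
      have h3 := abs_le.1 (hcoord n (m i) i hn (hmB i))
      have h4 := hm i n hn
      rw [hrepri i hi] at h2
      rw [h1]
      simp only [hc]
      constructor <;> nlinarith
    have hax : b.repr (r • (n : E3)) 0 ∈ Icc (1 - d ^ 2) (1 + h) := by
      have h1 : b.repr (r • (n : E3)) 0 = r * b.repr (n : E3) 0 := by simp
      have h2 : b.repr (n : E3) 0 ≤ 1 := by
        refine (le_abs_self _).trans ?_
        rw [← Real.norm_eq_abs]
        refine (PiLp.norm_apply_le _ 0).trans ?_
        rw [b.repr.norm_map, norm_eq_of_mem_sphere]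
      have h3 : dist n e ^ 2 = 2 - 2 * b.repr (n : E3) 0 := by
        rw [Subtype.dist_eq, dist_eq_norm, @norm_sub_sq_real, norm_eq_of_mem_sphere,
          norm_eq_of_mem_sphere, b.repr_apply_apply, hb, real_inner_comm]
        ring
      have h4 := hdist n hn e he
      have h5 : 1 - d ^ 2 ≤ b.repr (n : E3) 0 := by
        nlinarith [dist_nonneg (x := n) (y := e)]
      have h6 : 0 ≤ b.repr (n : E3) 0 := by nlinarith
      rw [h1]
      constructor <;> nlinarith
    intro i
    fin_cases i
    · exact hax
    · exact hlat 1 (by decide)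
    · exact hlat 2 (by decide)
  · rw [volume_orthonormal_box, Fin.prod_univ_three, ← ENNReal.ofReal_mul' , ← ENNReal.ofReal_mul']
    · refine ENNReal.ofReal_le_ofReal (le_of_eq ?_)
      simp [hl, hu]
      ring
    · simp [hl, hu]; nlinarith
    · simp [hl, hu]; nlinarith

/-- Surface measure on the sphere of radius `R` about the origin, as a measure on `ℝ³`. -/
def sphereSurf (R : ℝ) : Measure E3 :=
  ENNReal.ofReal (R ^ 2) • unitSurf.map fun n : sphere (0 : E3) 1 => R • (n : E3)

lemma measurableEmbedding_sphere {R : ℝ} (hR : 0 < R) :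
    MeasurableEmbedding fun n : sphere (0 : E3) 1 => R • (n : E3) := by
  refine (Continuous.isClosedEmbedding (by fun_prop) fun x y hxy => ?_).measurableEmbedding
  exact Subtype.ext (smul_right_injective E3 hR.ne' hxy)

lemma sphereSurf_le_mul {R : ℝ} (hR : 0 < R) {h : ℝ} (h0 : 0 < h) (h1 : h ≤ 1) :
    (ENNReal.ofReal ((1 + 2 * h) ^ 2 * (1 + h)))⁻¹ • sphereSurf R ≤ μH[2] := by
  refine Measure.le_hausdorffMeasure 2 _ (ENNReal.ofReal (R * h)) (by simp; positivity) ?_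
  intro s hs
  have hk : 0 < (1 + 2 * h) ^ 2 * (1 + h) := by positivity
  have hfin : ediam s ≠ ∞ := ne_top_of_le_ne_top ENNReal.ofReal_ne_top hs
  have hdR : diam s ≤ R * h := ENNReal.toReal_le_of_le_ofReal (by positivity) hs
  set d := diam s / R with hd
  have hd0 : 0 ≤ d := div_nonneg diam_nonneg hR.le
  have hdh : d ≤ h := by rw [hd, div_le_iff₀ hR]; linarith
  have hRd : R * d = diam s := by rw [hd]; field_simp
  set A : Set (sphere (0 : E3) 1) := (fun n : sphere (0 : E3) 1 => R • (n : E3)) ⁻¹' s with hA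
  have hdist : ∀ n ∈ closure A, ∀ m ∈ closure A, dist n m ≤ d := by
    have key : ediam A ≤ ENNReal.ofReal d := by
      refine ediam_le fun n hn m hm => ?_
      rw [edist_dist]
      refine ENNReal.ofReal_le_ofReal ?_
      have := dist_le_diam_of_mem' hfin hn hm
      simp only at this
      rw [dist_smul₀, Real.norm_of_nonneg hR.le, ← hRd] at this
      exact le_of_mul_le_mul_left this hR
    intro n hn m hm
    have := edist_le_ediam_of_mem hn hm
    rw [ediam_closure] at this
    rw [edist_dist] at this
    exact (ENNReal.ofReal_le_ofReal_iff hd0).1 (this.trans key)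
  have hmain := unitSurf_mul_le_of_dist_le (h := h) isClosed_closure hd0 (hdh.trans h1) hdist
  have hmain2 : unitSurf A ≤ ENNReal.ofReal (d ^ 2 * ((1 + 2 * h) ^ 2 * (1 + h))) := by
    have h3 : unitSurf A * ENNReal.ofReal h ≤
        ENNReal.ofReal (d ^ 2 * ((1 + 2 * h) ^ 2 * (1 + h))) * ENNReal.ofReal h := by
      rw [← ENNReal.ofReal_mul (by positivity)]
      refine (mul_le_mul_left (measure_mono subset_closure) _).trans (hmain.trans ?_)
      refine ENNReal.ofReal_le_ofReal ?_
      have : d ^ 2 ≤ h * h := by nlinarith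
      calc (d * (1 + 2 * h)) ^ 2 * (h + d ^ 2) ≤ (d * (1 + 2 * h)) ^ 2 * (h + h * h) := by gcongr
        _ = _ := by ring
    exact (ENNReal.mul_le_mul_iff_left (by simpa using h0) ENNReal.ofReal_ne_top).1 h3
  rw [Measure.smul_apply, sphereSurf, Measure.smul_apply, (measurableEmbedding_sphere hR).map_apply,
    smul_eq_mul, smul_eq_mul]
  calc _ ≤ (ENNReal.ofReal ((1 + 2 * h) ^ 2 * (1 + h)))⁻¹ * (ENNReal.ofReal (R ^ 2) *
        ENNReal.ofReal (d ^ 2 * ((1 + 2 * h) ^ 2 * (1 + h)))) := by gcongr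
    _ = ENNReal.ofReal (diam s ^ 2) := by
      rw [← ENNReal.ofReal_inv_of_pos hk, ← ENNReal.ofReal_mul (by positivity),
        ← ENNReal.ofReal_mul (by positivity), ← hRd]
      congr 1
      field_simp
    _ ≤ _ := by
      rw [ENNReal.ofReal_pow diam_nonneg, diam, ENNReal.ofReal_toReal hfin]
      norm_num

lemma sphereSurf_le_hausdorffMeasure {R : ℝ} (hR : 0 < R) : sphereSurf R ≤ μH[2] := by
  refine Measure.le_iff.2 fun s _ => ?_
  have hlim : Filter.Tendsto (fun h : ℝ => ENNReal.ofReal ((1 + 2 * h) ^ 2 * (1 + h)) * μH[2] s)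
      (nhdsWithin 0 (Ioi 0)) (nhds (ENNReal.ofReal 1 * μH[2] s)) := by
    refine ENNReal.Tendsto.mul_const (ENNReal.tendsto_ofReal ?_) (Or.inl (by simp))
    have : Continuous fun h : ℝ => (1 + 2 * h) ^ 2 * (1 + h) := by fun_prop
    have h := (this.tendsto 0).mono_left (nhdsWithin_le_nhds (s := Ioi 0))
    simpa using h
  rw [ENNReal.ofReal_one, one_mul] at hlim
  refine ge_of_tendsto hlim ?_
  filter_upwards [Ioc_mem_nhdsGT (zero_lt_one' ℝ)] with h hh
  have hk : 0 < (1 + 2 * h) ^ 2 * (1 + h) := by have := hh.1; positivity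
  have := Measure.le_iff'.1 (sphereSurf_le_mul hR hh.1 hh.2) s
  rw [Measure.smul_apply, smul_eq_mul] at this
  rwa [ENNReal.inv_mul_le_iff (by simpa using hk) ENNReal.ofReal_ne_top] at this

lemma hausdorffMeasure_sphere_lt_top {R : ℝ} (hR : 0 < R) : μH[2] (sphere (0 : E3) R) < ∞ := by
  set f : (Fin 2 → ℝ) → E3 := fun v =>
    !₂[R * sin (v 0) * cos (v 1), R * sin (v 0) * sin (v 1), R * cos (v 0)] with hf
  have hfc : ContDiff ℝ 1 f := by
    rw [contDiff_euclidean]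
    intro i
    fin_cases i <;> simp [hf] <;> fun_prop
  obtain ⟨K, hK⟩ := hfc.locallyLipschitz.locallyLipschitzOn.exists_lipschitzOnWith_of_compact
    (isCompact_Icc (a := fun _ : Fin 2 => -π) (b := fun _ => π))
  have hsub : sphere (0 : E3) R ⊆ f '' Icc (fun _ => -π) (fun _ => π) := by
    intro x hx
    have hn : x 0 ^ 2 + x 1 ^ 2 + x 2 ^ 2 = R ^ 2 := by
      have := EuclideanSpace.real_norm_sq_eq x
      rw [mem_sphere_zero_iff_norm.1 hx, Fin.sum_univ_three] at this
      exact this.symm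
    set z : ℂ := ⟨x 0, x 1⟩ with hz
    have hz1 : ‖z‖ = √(x 0 ^ 2 + x 1 ^ 2) := by
      rw [Complex.norm_eq_sqrt_sq_add_sq]
    have h1 : -1 ≤ x 2 / R := by rw [le_div_iff₀ hR]; nlinarith [sq_nonneg (x 0), sq_nonneg (x 1)]
    have h2 : x 2 / R ≤ 1 := by rw [div_le_iff₀ hR]; nlinarith [sq_nonneg (x 0), sq_nonneg (x 1)]
    have hs : R * √(1 - (x 2 / R) ^ 2) = ‖z‖ := by
      rw [hz1]
      have : x 0 ^ 2 + x 1 ^ 2 = R ^ 2 * (1 - (x 2 / R) ^ 2) := by field_simp; linarith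
      rw [this, Real.sqrt_mul (sq_nonneg R), Real.sqrt_sq hR.le]
    refine ⟨![arccos (x 2 / R), z.arg], ?_, ?_⟩
    · constructor <;> intro i <;> fin_cases i <;> simp
      · linarith [arccos_nonneg (x 2 / R), pi_pos]
      · exact (Complex.neg_pi_lt_arg z).le
      · exact arccos_le_pi _
      · exact Complex.arg_le_pi z
    · ext i
      fin_cases i
      · simp [hf, sin_arccos, hs]; simp [hz]
      · simp [hf, sin_arccos, hs]; simp [hz]
      · simp [hf, cos_arccos h1 h2]; field_simp
  calc μH[2] (sphere (0 : E3) R) ≤ μH[2] (f '' Icc (fun _ => -π) (fun _ => π)) := measure_mono hsub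
    _ ≤ (K : ℝ≥0∞) ^ (2 : ℝ) * μH[2] (Icc (fun _ : Fin 2 => -π) (fun _ => π)) :=
      hK.hausdorffMeasure_image_le (by norm_num)
    _ < ∞ := by
      have : (μH[2] : Measure (Fin 2 → ℝ)) = volume := by
        rw [← hausdorffMeasure_pi_real]; simp
      rw [this]
      exact ENNReal.mul_lt_top (by simp) isCompact_Icc.measure_lt_top

lemma integral_unitSurf_le_sphInt {R : ℝ} (hR : 0 < R) {q : E3 → ℝ}
    (hq : ContinuousOn q (sphere 0 R)) (hq0 : ∀ x ∈ sphere (0 : E3) R, 0 ≤ q x) :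
    R ^ 2 * ∫ n : sphere (0 : E3) 1, q (R • (n : E3)) ∂unitSurf ≤ sphInt R q := by
  have hm : MeasurableSet (sphere (0 : E3) R) := isClosed_sphere.measurableSet
  have : IsFiniteMeasure ((μH[2] : Measure E3).restrict (sphere 0 R)) :=
    isFiniteMeasure_restrict.2 (hausdorffMeasure_sphere_lt_top hR).ne
  have hfi : IntegrableOn q (sphere 0 R) μH[2] := by
    obtain ⟨C, hC⟩ := (isCompact_sphere (0 : E3) R).exists_bound_of_continuousOn hq
    refine Integrable.of_bound (hq.aestronglyMeasurable hm) C ?_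
    filter_upwards [ae_restrict_mem hm] with x hx using hC x hx
  have hres : sphereSurf R = (sphereSurf R).restrict (sphere 0 R) := by
    refine (Measure.restrict_eq_self_of_ae_mem ?_).symm
    refine Measure.ae_smul_measure ?_ _
    rw [(measurableEmbedding_sphere hR).ae_map_iff]
    exact Filter.Eventually.of_forall fun n => by simp [norm_smul_sphere n hR.le]
  calc _ = ∫ x, q x ∂(sphereSurf R) := by
        rw [sphereSurf, integral_smul_measure, (measurableEmbedding_sphere hR).integral_map,
          ENNReal.toReal_ofReal (by positivity), smul_eq_mul]
    _ ≤ _ := by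
        rw [hres, sphInt]
        refine integral_mono_measure (Measure.restrict_mono le_rfl
          (sphereSurf_le_hausdorffMeasure hR)) ?_ hfi
        filter_upwards [ae_restrict_mem hm] with x hx using hq0 x hx

/-- The generator `x_i e_j - x_j e_i` of rotations in the `(i, j)`-plane. -/
def rotGen (i j : Fin 3) (x : E3) : E3 := x i • basis3 j - x j • basis3 i

lemma sum_smul_basis3 (x : E3) : ∑ i, x i • basis3 i = x := by
  ext k
  fin_cases k <;> simp [basis3, Fin.sum_univ_three]

lemma hasFDerivAt_fixT {u : E3 × ℝ → ℝ} {p : E3 × ℝ} (hu : DifferentiableAt ℝ u p) :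
    HasFDerivAt (fixT u p.2) ((fderiv ℝ u p).comp (ContinuousLinearMap.inl ℝ E3 ℝ)) p.1 :=
  HasFDerivAt.comp p.1 (f := fun y => (y, p.2)) (g := u) hu.hasFDerivAt
    (hasFDerivAt_prodMk_left p.1 p.2)

lemma pd_fixT {u : E3 × ℝ → ℝ} {p : E3 × ℝ} (hu : DifferentiableAt ℝ u p) (i : Fin 3) :
    pd i (fixT u p.2) p.1 = fderiv ℝ u p (basis3 i, 0) := by
  rw [pd, (hasFDerivAt_fixT hu).fderiv]
  rfl

lemma sum_mul_pd_fixT {u : E3 × ℝ → ℝ} {p : E3 × ℝ} (hu : DifferentiableAt ℝ u p) (v : E3) :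
    ∑ i, v i * pd i (fixT u p.2) p.1 = fderiv ℝ u p (v, 0) := by
  have h := congrArg (fun y => (fderiv ℝ u p).comp (ContinuousLinearMap.inl ℝ E3 ℝ) y)
    (sum_smul_basis3 v)
  simp only [map_sum, map_smul] at h
  simp only [pd_fixT hu]
  exact h

lemma pdrX_eq {u : E3 × ℝ → ℝ} {p : E3 × ℝ} (hu : DifferentiableAt ℝ u p) :
    pdrX u p = fderiv ℝ u p (‖p.1‖⁻¹ • p.1, 0) := by
  rw [pdrX, pdr, sum_mul_pd_fixT hu, ← smul_eq_mul, ← map_smul, Prod.smul_mk, smul_zero]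

lemma angX_eq {u : E3 × ℝ → ℝ} {p : E3 × ℝ} (hu : DifferentiableAt ℝ u p) (i j : Fin 3) :
    angX i j u p = fderiv ℝ u p (rotGen i j p.1, 0) := by
  have h : ((rotGen i j p.1, 0) : E3 × ℝ) = p.1 i • (basis3 j, 0) - p.1 j • (basis3 i, 0) := by
    simp [rotGen]
  rw [angX, ang, pd_fixT hu, pd_fixT hu, h, map_sub, map_smul, map_smul, smul_eq_mul, smul_eq_mul]

section regularity

variable {u : E3 × ℝ → ℝ} {S : Set (E3 × ℝ)} {m n : WithTop ℕ∞}

lemma contDiffOn_fderiv_apply (hS : IsOpen S) (hu : ContDiffOn ℝ n u S) (hmn : m + 1 ≤ n)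
    {V : E3 × ℝ → E3 × ℝ} (hV : ContDiffOn ℝ m V S) :
    ContDiffOn ℝ m (fun p => fderiv ℝ u p (V p)) S :=
  (hu.fderiv_of_isOpen hS hmn).clm_apply hV

lemma ContDiffOn.differentiableAt_of_isOpen (hS : IsOpen S) (hu : ContDiffOn ℝ n u S) (hn : 1 ≤ n)
    {p : E3 × ℝ} (hp : p ∈ S) : DifferentiableAt ℝ u p :=
  (hu.contDiffAt (hS.mem_nhds hp)).differentiableAt (by rintro rfl; simp at hn)

lemma contDiffOn_pdt (hS : IsOpen S) (hu : ContDiffOn ℝ n u S) (hmn : m + 1 ≤ n) :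
    ContDiffOn ℝ m (pdt u) S :=
  contDiffOn_fderiv_apply hS hu hmn contDiffOn_const

lemma contDiffOn_angX (hS : IsOpen S) (hu : ContDiffOn ℝ n u S) (hmn : m + 1 ≤ n) (i j : Fin 3) :
    ContDiffOn ℝ m (angX i j u) S := by
  refine (contDiffOn_fderiv_apply hS hu hmn (V := fun p => (rotGen i j p.1, 0)) ?_).congr
    fun p hp => angX_eq (hu.differentiableAt_of_isOpen hS (le_add_self.trans hmn) hp) i j
  unfold rotGen
  fun_prop

lemma contDiffOn_pdrX (hS : IsOpen S) (h0 : ∀ p ∈ S, p.1 ≠ 0) (hu : ContDiffOn ℝ n u S)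
    (hmn : m + 1 ≤ n) : ContDiffOn ℝ m (pdrX u) S := by
  refine (contDiffOn_fderiv_apply hS hu hmn (V := fun p => (‖p.1‖⁻¹ • p.1, 0)) ?_).congr
    fun p hp => pdrX_eq (hu.differentiableAt_of_isOpen hS (le_add_self.trans hmn) hp)
  have hinv : ContDiffOn ℝ m (fun p : E3 × ℝ => ‖p.1‖⁻¹) S :=
    (contDiffOn_fst.norm ℝ h0).inv fun p hp => norm_ne_zero_iff.2 (h0 p hp)
  exact ContDiffOn.prodMk (hinv.smul contDiffOn_fst) contDiffOn_const

end regularity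

section rotation

/-- Rotation by the angle `θ` in the `(i, j)`-plane. -/
def rotFun (i j : Fin 3) (θ : ℝ) (x : E3) : E3 :=
  x + (cos θ - 1) • (x i • basis3 i + x j • basis3 j) + sin θ • rotGen i j x

lemma norm_rotFun {i j : Fin 3} (hij : i < j) (θ : ℝ) (x : E3) : ‖rotFun i j θ x‖ = ‖x‖ := by
  have h := sin_sq_add_cos_sq θ
  rw [← sq_eq_sq₀ (norm_nonneg _) (norm_nonneg _), EuclideanSpace.real_norm_sq_eq,
    EuclideanSpace.real_norm_sq_eq, Fin.sum_univ_three, Fin.sum_univ_three]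
  fin_cases i <;> fin_cases j <;> simp at hij <;> simp [rotFun, rotGen, basis3]
  · linear_combination (x 0 ^ 2 + x 1 ^ 2) * h
  · linear_combination (x 0 ^ 2 + x 2 ^ 2) * h
  · linear_combination (x 1 ^ 2 + x 2 ^ 2) * h

lemma rotFun_rotGen {i j : Fin 3} (hij : i < j) (θ : ℝ) (x : E3) :
    rotGen i j (rotFun i j θ x) =
      (-sin θ) • (x i • basis3 i + x j • basis3 j) + cos θ • rotGen i j x := by
  ext k
  fin_cases i <;> fin_cases j <;> simp at hij <;> fin_cases k <;>
    simp [rotFun, rotGen, basis3] <;> ring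

/-- `rotFun` as a linear isometry equivalence. -/
def rotEquiv {i j : Fin 3} (hij : i < j) (θ : ℝ) : E3 ≃ₗᵢ[ℝ] E3 :=
  LinearIsometry.toLinearIsometryEquiv
    { toFun := rotFun i j θ
      map_add' := fun x y => by simp only [rotFun, rotGen, PiLp.add_apply]; module
      map_smul' := fun c x => by
        simp only [rotFun, rotGen, PiLp.smul_apply, RingHom.id_apply, smul_eq_mul]; module
      norm_map' := norm_rotFun hij θ } rfl

lemma continuous_rotFun (i j : Fin 3) : Continuous fun q : ℝ × E3 => rotFun i j q.1 q.2 := by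
  unfold rotFun rotGen
  fun_prop

lemma hasDerivAt_rotFun {i j : Fin 3} (hij : i < j) (x : E3) (θ : ℝ) :
    HasDerivAt (fun θ => rotFun i j θ x) (rotGen i j (rotFun i j θ x)) θ := by
  rw [rotFun_rotGen hij]
  unfold rotFun
  have h1 := (((hasDerivAt_cos θ).sub_const 1).smul_const (x i • basis3 i + x j • basis3 j))
  have h2 := ((hasDerivAt_sin θ).smul_const (rotGen i j x))
  exact (h1.const_add x).add h2

variable {D S : Set (E3 × ℝ)}

lemma setIntegral_angX_eq_zero (hD : IsCompact D) (hS : IsOpen S) (hDS : D ⊆ S)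
    (hDrot : ∀ x y : E3, ∀ t : ℝ, ‖x‖ = ‖y‖ → (x, t) ∈ D → (y, t) ∈ D)
    (hD0 : ∀ p ∈ D, p.1 ≠ 0) {h : E3 × ℝ → ℝ} (hh : ContDiffOn ℝ 1 h S)
    {i j : Fin 3} (hij : i < j) :
    ∫ p in D, (‖p.1‖ ^ 4)⁻¹ * angX i j h p = 0 := by
  set G : E3 × ℝ → ℝ := fun p => (‖p.1‖ ^ 4)⁻¹ * angX i j h p with hG
  have hGc : ContinuousOn G D := by
    refine ContinuousOn.mul (ContinuousOn.inv₀ (by fun_prop) fun p hp => ?_)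
      ((contDiffOn_angX (m := 0) hS hh (by norm_num) i j).continuousOn.mono hDS)
    have := norm_pos_iff.2 (hD0 p hp)
    positivity
  set ρ : ℝ → E3 × ℝ → E3 × ℝ := fun θ p => (rotFun i j θ p.1, p.2) with hρ
  have hρD : ∀ θ p, p ∈ D → ρ θ p ∈ D := fun θ p hp =>
    hDrot p.1 _ p.2 (norm_rotFun hij θ p.1).symm hp
  have hpre : ∀ θ, ρ θ ⁻¹' D = D := fun θ => by
    ext p
    exact ⟨fun hp => hDrot _ p.1 p.2 (norm_rotFun hij θ p.1) hp, fun hp => hρD θ p hp⟩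
  have hinv : ∀ θ, ∫ p in D, G (ρ θ p) = ∫ p in D, G p := by
    intro θ
    have hmp : MeasurePreserving (ρ θ) :=
      (rotEquiv hij θ).measurePreserving.prod (MeasurePreserving.id _)
    have hme : MeasurableEmbedding (ρ θ) :=
      ((rotEquiv hij θ).toHomeomorph.prodCongr (Homeomorph.refl ℝ)).measurableEmbedding
    have := hmp.setIntegral_preimage_emb hme G D
    rwa [hpre] at this
  have hcont : ContinuousOn (fun q : ℝ × (E3 × ℝ) => G (ρ q.1 q.2)) (Icc 0 (2 * π) ×ˢ D) := by
    refine hGc.comp (Continuous.continuousOn ?_) fun q hq => hρD q.1 q.2 hq.2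
    exact ((continuous_rotFun i j).comp (by fun_prop : Continuous fun q : ℝ × (E3 × ℝ) =>
      (q.1, q.2.1))).prodMk (by fun_prop)
  have hfi : Integrable (fun q : ℝ × (E3 × ℝ) => G (ρ q.1 q.2))
      ((volume.restrict (Ioc 0 (2 * π))).prod (volume.restrict D)) := by
    rw [Measure.prod_restrict]
    exact (hcont.integrableOn_compact (isCompact_Icc.prod hD)).mono_set
      (prod_mono Ioc_subset_Icc_self le_rfl)
  have hswap := integral_integral_swap (f := fun θ p => G (ρ θ p)) hfi
  have hzero : ∀ p ∈ D, ∫ θ in Ioc 0 (2 * π), G (ρ θ p) = 0 := by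
    intro p hp
    have hd : ∀ θ ∈ uIcc 0 (2 * π), HasDerivAt (fun θ => (‖p.1‖ ^ 4)⁻¹ * h (ρ θ p))
        (G (ρ θ p)) θ := by
      intro θ _
      have hdiff : DifferentiableAt ℝ h (ρ θ p) :=
        hh.differentiableAt_of_isOpen hS le_rfl (hDS (hρD θ p hp))
      have h1 : HasDerivAt (fun θ => ρ θ p) (rotGen i j (rotFun i j θ p.1), 0) θ :=
        (hasDerivAt_rotFun hij p.1 θ).prodMk (hasDerivAt_const θ p.2)
      have h2 := (hdiff.hasFDerivAt.comp_hasDerivAt θ h1).const_mul ((‖p.1‖ ^ 4)⁻¹)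
      simp only [hG]
      rw [angX_eq hdiff]
      convert! h2 using 3
      exact congrArg (· ^ 4) (norm_rotFun hij θ p.1)
    have hci : IntervalIntegrable (fun θ => G (ρ θ p)) volume 0 (2 * π) := by
      refine ContinuousOn.intervalIntegrable ?_
      rw [uIcc_of_le (by positivity)]
      exact hcont.comp (f := fun θ => (θ, p)) (by fun_prop) fun θ hθ => ⟨hθ, hp⟩
    have := intervalIntegral.integral_eq_sub_of_hasDerivAt hd hci
    rw [← intervalIntegral.integral_of_le (by positivity), this]
    simp [hρ, rotFun]
  rw [setIntegral_congr_fun hD.measurableSet hzero] at hswap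
  simp only [hinv, integral_zero] at hswap
  have hpi : ¬ 2 * π ≤ 0 := not_le.2 (by positivity)
  simpa [hpi] using hswap

end rotation

section pointwise

lemma norm_sq_fin_three (x : E3) : ‖x‖ ^ 2 = x 0 ^ 2 + x 1 ^ 2 + x 2 ^ 2 := by
  rw [EuclideanSpace.real_norm_sq_eq, Fin.sum_univ_three]

lemma gradsq_eq (f : E3 → ℝ) {x : E3} (hx : x ≠ 0) :
    gradsq f x = pdr f x ^ 2 +
      (‖x‖ ^ 2)⁻¹ * (ang 0 1 f x ^ 2 + ang 0 2 f x ^ 2 + ang 1 2 f x ^ 2) := by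
  have h0 : ‖x‖ ≠ 0 := norm_ne_zero_iff.2 hx
  have h2 : x 0 ^ 2 + x 1 ^ 2 + x 2 ^ 2 ≠ 0 := by rw [← norm_sq_fin_three]; positivity
  simp only [gradsq, pdr, ang, Fin.sum_univ_three, mul_pow, inv_pow, norm_sq_fin_three]
  field_simp
  ring

lemma angLapX_eq (u : E3 × ℝ → ℝ) (p : E3 × ℝ) :
    angLapX u p = angX 0 1 (angX 0 1 u) p + angX 0 2 (angX 0 2 u) p
      + angX 1 2 (angX 1 2 u) p := by
  have h : angLapX u p = ∑ i, ∑ j, if i < j then angX i j (angX i j u) p else 0 := rfl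
  rw [h]
  simp [Fin.sum_univ_three]

lemma gradsqX_eq (u : E3 × ℝ → ℝ) {p : E3 × ℝ} (hp : p.1 ≠ 0) :
    gradsqX u p = pdrX u p ^ 2 +
      (‖p.1‖ ^ 2)⁻¹ * (angX 0 1 u p ^ 2 + angX 0 2 u p ^ 2 + angX 1 2 u p ^ 2) :=
  gradsq_eq _ hp

lemma angX_mul {u v : E3 × ℝ → ℝ} {p : E3 × ℝ} (hu : DifferentiableAt ℝ u p)
    (hv : DifferentiableAt ℝ v p) (i j : Fin 3) :
    angX i j (fun q => u q * v q) p = angX i j u p * v p + u p * angX i j v p := by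
  rw [angX_eq hu, angX_eq hv, angX_eq (hu.fun_mul hv), fderiv_fun_mul hu hv]
  simp
  ring

/-- Along vertical lines, `∂_t` commutes with spatial directional derivatives. -/
lemma hasDerivAt_fderiv_time {u : E3 × ℝ → ℝ} {x : E3} {t : ℝ} (hu : ContDiffAt ℝ 2 u (x, t))
    (v : E3) :
    HasDerivAt (fun τ => fderiv ℝ u (x, τ) (v, 0)) (fderiv ℝ (pdt u) (x, t) (v, 0)) t := by
  have hd : DifferentiableAt ℝ (fderiv ℝ u) (x, t) :=
    (hu.fderiv_right (m := 1) (by norm_num)).differentiableAt (by norm_num)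
  have hsymm := hu.isSymmSndFDerivAt (by simp)
  have h1 : HasDerivAt (fun τ => fderiv ℝ u (x, τ))
      (fderiv ℝ (fderiv ℝ u) (x, t) (0, 1)) t :=
    hd.hasFDerivAt.comp_hasDerivAt (f := fun τ => (x, τ)) t
      ((hasDerivAt_const t x).prodMk (hasDerivAt_id t))
  have h2 : fderiv ℝ (pdt u) (x, t) (v, 0) = fderiv ℝ (fderiv ℝ u) (x, t) (v, 0) (0, 1) := by
    have h := hd.hasFDerivAt.clm_apply (hasFDerivAt_const ((0, 1) : E3 × ℝ) (x, t))
    have h3 : fderiv ℝ (pdt u) (x, t) = _ := h.fderiv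
    rw [h3]
    simp
  rw [h2, hsymm.eq]
  exact h1.clm_apply (hasDerivAt_const t ((v, 0) : E3 × ℝ)) |>.congr_deriv (by simp)

lemma hasDerivAt_time {u : E3 × ℝ → ℝ} {x : E3} {t : ℝ} (hu : DifferentiableAt ℝ u (x, t)) :
    HasDerivAt (fun τ => u (x, τ)) (pdt u (x, t)) t :=
  hu.hasFDerivAt.comp_hasDerivAt (f := fun τ => (x, τ)) t
    ((hasDerivAt_const t x).prodMk (hasDerivAt_id t))

lemma hasDerivAt_radius {u : E3 × ℝ → ℝ} {n : E3} (hn : ‖n‖ = 1) {r t : ℝ} (hr : 0 < r)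
    (hu : DifferentiableAt ℝ u (r • n, t)) :
    HasDerivAt (fun ρ : ℝ => u (ρ • n, t)) (pdrX u (r • n, t)) r := by
  have h : ‖r • n‖⁻¹ • r • n = n := by
    rw [norm_smul, hn, mul_one, Real.norm_of_nonneg hr.le, smul_smul, inv_mul_cancel₀ hr.ne',
      one_smul]
  rw [pdrX_eq hu]
  simp only [h]
  exact hu.hasFDerivAt.comp_hasDerivAt (f := fun ρ : ℝ => (ρ • n, t)) r
    ((((hasDerivAt_id r).smul_const n).congr_deriv (by simp)).prodMk (hasDerivAt_const r t))

/-- The energy density `w² + (∂_t w)² + |∇w|²`. -/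
def eDen (w : E3 × ℝ → ℝ) (p : E3 × ℝ) : ℝ := w p ^ 2 + pdt w p ^ 2 + gradsqX w p

/-- The radial energy flux `2 ∂_t w ∂_r w`. -/
def gFlux (w : E3 × ℝ → ℝ) (p : E3 × ℝ) : ℝ := 2 * (pdt w p * pdrX w p)

/-- The time derivative of the energy density. -/
def eDot (w : E3 × ℝ → ℝ) (p : E3 × ℝ) : ℝ :=
  2 * (w p * pdt w p) + 2 * (pdt w p * pdt (pdt w) p) + 2 * (pdrX w p * pdrX (pdt w) p)
    + (‖p.1‖ ^ 2)⁻¹ * (2 * (angX 0 1 w p * angX 0 1 (pdt w) p)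
      + 2 * (angX 0 2 w p * angX 0 2 (pdt w) p) + 2 * (angX 1 2 w p * angX 1 2 (pdt w) p))

/-- The radial derivative of the radial energy flux. -/
def gDot (w : E3 × ℝ → ℝ) (p : E3 × ℝ) : ℝ :=
  2 * (pdrX (pdt w) p * pdrX w p + pdt w p * pdrX (pdrX w) p)

variable {w : E3 × ℝ → ℝ} {S : Set (E3 × ℝ)}

lemma hasDerivAt_eDen (hS : IsOpen S) (h0 : ∀ p ∈ S, p.1 ≠ 0) (hw : ContDiffOn ℝ 2 w S)
    {x : E3} {t : ℝ} (hp : (x, t) ∈ S) :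
    HasDerivAt (fun τ => eDen w (x, τ)) (eDot w (x, t)) t := by
  have hx : x ≠ 0 := h0 _ hp
  have hc := hw.contDiffAt (hS.mem_nhds hp)
  have hd : ∀ q ∈ S, DifferentiableAt ℝ w q := fun q hq =>
    hw.differentiableAt_of_isOpen hS (by norm_num) hq
  have hdt : DifferentiableAt ℝ (pdt w) (x, t) :=
    (contDiffOn_pdt (m := 1) hS hw (by norm_num)).differentiableAt_of_isOpen hS le_rfl hp
  have hev : ∀ᶠ τ in nhds t, (x, τ) ∈ S :=
    (Continuous.prodMk_right x).continuousAt.eventually (hS.mem_nhds hp)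
  have hr : HasDerivAt (fun τ => pdrX w (x, τ)) (pdrX (pdt w) (x, t)) t := by
    rw [pdrX_eq hdt]
    exact (hasDerivAt_fderiv_time hc _).congr_of_eventuallyEq
      (hev.mono fun τ hτ => pdrX_eq (hd _ hτ))
  have ha : ∀ i j, HasDerivAt (fun τ => angX i j w (x, τ)) (angX i j (pdt w) (x, t)) t := by
    intro i j
    rw [angX_eq hdt]
    exact (hasDerivAt_fderiv_time hc _).congr_of_eventuallyEq
      (hev.mono fun τ hτ => angX_eq (hd _ hτ) i j)
  have h := (((hasDerivAt_time (hd _ hp)).pow 2).add ((hasDerivAt_time hdt).pow 2)).add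
    ((hr.pow 2).add (((((ha 0 1).pow 2).add ((ha 0 2).pow 2)).add ((ha 1 2).pow 2)).const_mul
      ((‖x‖ ^ 2)⁻¹)))
  refine (h.congr_deriv ?_).congr_of_eventuallyEq (Filter.Eventually.of_forall fun τ => ?_)
  · simp only [eDot]; push_cast; ring
  · simp only [eDen]; rw [gradsqX_eq (p := (x, τ)) w hx]; rfl

lemma hasDerivAt_gFlux (hS : IsOpen S) (h0 : ∀ p ∈ S, p.1 ≠ 0) (hw : ContDiffOn ℝ 2 w S)
    {n : E3} (hn : ‖n‖ = 1) {r t : ℝ} (hr : 0 < r) (hp : (r • n, t) ∈ S) :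
    HasDerivAt (fun ρ : ℝ => gFlux w (ρ • n, t)) (gDot w (r • n, t)) r := by
  have hdt := hasDerivAt_radius hn hr
    ((contDiffOn_pdt (m := 1) hS hw (by norm_num)).differentiableAt_of_isOpen hS le_rfl hp)
  have hdr := hasDerivAt_radius hn hr
    ((contDiffOn_pdrX (m := 1) hS h0 hw (by norm_num)).differentiableAt_of_isOpen hS le_rfl hp)
  exact (hdt.mul hdr).const_mul 2

/-- The product of `2 ∂_t w` with `F + w` is a space-time divergence. -/
lemma two_mul_pdt_mul_Fop (hS : IsOpen S) (hw : ContDiffOn ℝ 2 w S) {p : E3 × ℝ} (hp : p ∈ S) :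
    2 * (pdt w p * (Fop w p + w p)) = eDot w p - gDot w p
      - 2 * (‖p.1‖ ^ 2)⁻¹ * (angX 0 1 (fun q => pdt w q * angX 0 1 w q) p
        + angX 0 2 (fun q => pdt w q * angX 0 2 w q) p
        + angX 1 2 (fun q => pdt w q * angX 1 2 w q) p) := by
  have hdt := (contDiffOn_pdt (m := 1) hS hw (by norm_num)).differentiableAt_of_isOpen hS le_rfl hp
  have ha := fun i j => (contDiffOn_angX (m := 1) hS hw (by norm_num) i j).differentiableAt_of_isOpen
    hS le_rfl hp
  rw [angX_mul hdt (ha 0 1), angX_mul hdt (ha 0 2), angX_mul hdt (ha 1 2), Fop, angLapX_eq,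
    eDot, gDot]
  ring

lemma hasFDerivAt_norm_of_ne_zero {x : E3} (hx : x ≠ 0) :
    HasFDerivAt (fun y : E3 => ‖y‖) (‖x‖⁻¹ • innerSL ℝ x) x := by
  have h := (hasStrictFDerivAt_norm_sq x).hasFDerivAt.sqrt (by simpa using hx)
  simp only [Real.sqrt_sq (norm_nonneg _)] at h
  refine h.congr_fderiv ?_
  ext v
  simp
  ring

/-- The tangential energy on a characteristic cone `t = c + σ|x|`. -/
lemma sq_add_gradsq_cone {x : E3} {c σ : ℝ} (hσ : σ ^ 2 = 1) (hx : x ≠ 0)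
    (hu : DifferentiableAt ℝ w (x, c + σ * ‖x‖)) :
    w (x, c + σ * ‖x‖) ^ 2 + gradsq (fun y => w (y, c + σ * ‖y‖)) x =
      eDen w (x, c + σ * ‖x‖) + σ * gFlux w (x, c + σ * ‖x‖) := by
  set b := pdt w (x, c + σ * ‖x‖) with hb
  have h1 : ‖x‖ ≠ 0 := norm_ne_zero_iff.2 hx
  have hpd : ∀ i, pd i (fun y => w (y, c + σ * ‖y‖)) x =
      pd i (fixT w (c + σ * ‖x‖)) x + σ * (‖x‖⁻¹ * x i) * b := by
    intro i
    have h := hu.hasFDerivAt.comp x (f := fun y => (y, c + σ * ‖y‖)) ((hasFDerivAt_id x).prodMk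
      (((hasFDerivAt_norm_of_ne_zero hx).const_mul σ).const_add c))
    have hv : ((basis3 i, σ * (‖x‖⁻¹ * x i)) : E3 × ℝ) =
        (basis3 i, 0) + (σ * (‖x‖⁻¹ * x i)) • (0, 1) := by simp
    have h2 : inner ℝ x (basis3 i) = x i := by
      simp [basis3, EuclideanSpace.inner_single_right]
    rw [pd, show fderiv ℝ (fun y => w (y, c + σ * ‖y‖)) x = _ from h.fderiv]
    rw [pd_fixT (p := (x, c + σ * ‖x‖)) hu, hb, pdt]
    have h3 := congrArg (fderiv ℝ w (x, c + σ * ‖x‖)) hv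
    rw [map_add, map_smul, smul_eq_mul] at h3
    rw [← h3]
    simp [h2]
  have hn : (‖x‖⁻¹ * x 0) ^ 2 + (‖x‖⁻¹ * x 1) ^ 2 + (‖x‖⁻¹ * x 2) ^ 2 = 1 := by
    rw [mul_pow, mul_pow, mul_pow, ← mul_add, ← mul_add, ← norm_sq_fin_three]
    field_simp
  simp only [eDen, gFlux, gradsqX, gradsq, pdrX, pdr, hpd, Fin.sum_univ_three, ← hb]
  linear_combination σ ^ 2 * b ^ 2 * hn + b ^ 2 * hσ

lemma continuousOn_gFlux (hS : IsOpen S) (h0 : ∀ p ∈ S, p.1 ≠ 0) (hw : ContDiffOn ℝ 2 w S) :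
    ContinuousOn (gFlux w) S :=
  continuousOn_const.mul ((contDiffOn_pdt (m := 1) hS hw (by norm_num)).continuousOn.mul
    (contDiffOn_pdrX (m := 1) hS h0 hw (by norm_num)).continuousOn)

lemma continuousOn_inv_norm_sq (h0 : ∀ p ∈ S, p.1 ≠ 0) :
    ContinuousOn (fun p : E3 × ℝ => (‖p.1‖ ^ 2)⁻¹) S :=
  ContinuousOn.inv₀ (by fun_prop) fun p hp => pow_ne_zero 2 (norm_ne_zero_iff.2 (h0 p hp))

lemma continuousOn_eDen (hS : IsOpen S) (h0 : ∀ p ∈ S, p.1 ≠ 0) (hw : ContDiffOn ℝ 2 w S) :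
    ContinuousOn (eDen w) S := by
  have ht := (contDiffOn_pdt (m := 1) hS hw (by norm_num)).continuousOn
  have hr := (contDiffOn_pdrX (m := 1) hS h0 hw (by norm_num)).continuousOn
  have ha := fun i j => (contDiffOn_angX (m := 1) hS hw (by norm_num) i j).continuousOn
  refine ContinuousOn.add ((hw.continuousOn.pow 2).add (ht.pow 2)) (ContinuousOn.congr
    ((hr.pow 2).add ((continuousOn_inv_norm_sq h0).mul
      ((((ha 0 1).pow 2).add ((ha 0 2).pow 2)).add ((ha 1 2).pow 2)))) fun p hp => ?_)
  rw [gradsqX_eq w (h0 p hp)]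
  rfl

lemma continuousOn_gDot (hS : IsOpen S) (h0 : ∀ p ∈ S, p.1 ≠ 0) (hw : ContDiffOn ℝ 2 w S) :
    ContinuousOn (gDot w) S := by
  have ht := contDiffOn_pdt (m := 1) hS hw (by norm_num)
  have hr := contDiffOn_pdrX (m := 1) hS h0 hw (by norm_num)
  have hrt := (contDiffOn_pdrX (m := 0) hS h0 ht (by norm_num)).continuousOn
  have hrr := (contDiffOn_pdrX (m := 0) hS h0 hr (by norm_num)).continuousOn
  exact continuousOn_const.mul ((hrt.mul hr.continuousOn).add (ht.continuousOn.mul hrr))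

lemma continuousOn_eDot (hS : IsOpen S) (h0 : ∀ p ∈ S, p.1 ≠ 0) (hw : ContDiffOn ℝ 2 w S) :
    ContinuousOn (eDot w) S := by
  have ht := contDiffOn_pdt (m := 1) hS hw (by norm_num)
  have hr := (contDiffOn_pdrX (m := 1) hS h0 hw (by norm_num)).continuousOn
  have hrt := (contDiffOn_pdrX (m := 0) hS h0 ht (by norm_num)).continuousOn
  have htt := (contDiffOn_pdt (m := 0) hS ht (by norm_num)).continuousOn
  have ha := fun i j => (contDiffOn_angX (m := 1) hS hw (by norm_num) i j).continuousOn
  have hat := fun i j => (contDiffOn_angX (m := 0) hS ht (by norm_num) i j).continuousOn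
  have hA := fun i j => (continuousOn_const (c := (2 : ℝ))).mul ((ha i j).mul (hat i j))
  exact (((continuousOn_const.mul (hw.continuousOn.mul ht.continuousOn)).add
    (continuousOn_const.mul (ht.continuousOn.mul htt))).add (continuousOn_const.mul
    (hr.mul hrt))).add ((continuousOn_inv_norm_sq h0).mul (((hA 0 1).add (hA 0 2)).add (hA 1 2)))

end pointwise

section fubini

variable {α β : Type*} [MeasurableSpace α] [MeasurableSpace β] {μ : Measure α} {ν : Measure β}
  [SFinite μ] [SFinite ν] {D : Set (α × β)} {f : α × β → ℝ}

lemma setIntegral_eq_integral_sections (hD : MeasurableSet D)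
    (hf : IntegrableOn f D (μ.prod ν)) :
    ∫ p in D, f p ∂μ.prod ν = ∫ x, ∫ y in {y | (x, y) ∈ D}, f (x, y) ∂ν ∂μ := by
  rw [← integral_indicator hD, integral_prod _ ((integrable_indicator_iff hD).2 hf)]
  refine integral_congr_ae (Filter.Eventually.of_forall fun x => ?_)
  exact integral_indicator (s := {y | (x, y) ∈ D}) (f := fun y => f (x, y))
    (measurable_prodMk_left hD)

lemma setIntegral_eq_integral_sections_symm (hD : MeasurableSet D)
    (hf : IntegrableOn f D (μ.prod ν)) :
    ∫ p in D, f p ∂μ.prod ν = ∫ y, ∫ x in {x | (x, y) ∈ D}, f (x, y) ∂μ ∂ν := by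
  rw [← integral_indicator hD, integral_prod_symm _ ((integrable_indicator_iff hD).2 hf)]
  refine integral_congr_ae (Filter.Eventually.of_forall fun y => ?_)
  exact integral_indicator (s := {x | (x, y) ∈ D}) (f := fun x => f (x, y))
    (measurable_prodMk_right hD)

end fubini

section annuli

lemma smul_sphere_mem_Ann {a b r : ℝ} (ha : 0 < a) (hr : r ∈ Icc a b) (n : sphere (0 : E3) 1) :
    r • (n : E3) ∈ Ann a b := by
  simpa only [Ann, mem_ofPred_eq, norm_smul_sphere n (ha.le.trans hr.1), mem_Icc] using hr

lemma intervalIntegrable_integral_of_continuousOn {X : Type*} [TopologicalSpace X]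
    [MeasurableSpace X] [BorelSpace X] [SecondCountableTopology X] [T2Space X] {μ : Measure X}
    [IsFiniteMeasureOnCompacts μ] [SFinite μ] {C : Set X} (hC : IsCompact C) {a b : ℝ} (hab : a ≤ b)
    {h : ℝ × X → ℝ} (hh : ContinuousOn h (Icc a b ×ˢ C)) :
    IntervalIntegrable (fun t => ∫ x in C, h (t, x) ∂μ) volume a b := by
  rw [intervalIntegrable_iff_integrableOn_Icc_of_le hab]
  have h1 : IntegrableOn h (Icc a b ×ˢ C) (volume.prod μ) :=
    hh.integrableOn_compact (isCompact_Icc.prod hC)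
  rw [IntegrableOn, ← Measure.prod_restrict] at h1
  exact h1.integral_prod_left

lemma intervalIntegrable_unitSurf {a b : ℝ} (hab : a ≤ b) {h : ℝ × sphere (0 : E3) 1 → ℝ}
    (hh : ContinuousOn h (Icc a b ×ˢ univ)) :
    IntervalIntegrable (fun t => ∫ n, h (t, n) ∂unitSurf) volume a b := by
  simpa using intervalIntegrable_integral_of_continuousOn (μ := unitSurf) isCompact_univ hab hh

lemma integral_ann_add_ann {a b c : ℝ} (ha : 0 < a) (hac : a ≤ c) (hcb : c ≤ b) {h : E3 → ℝ}
    (hh : ContinuousOn h (Ann a b)) :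
    (∫ x in Ann a c, (‖x‖ ^ 2)⁻¹ * h x) + ∫ x in Ann c b, (‖x‖ ^ 2)⁻¹ * h x =
      ∫ x in Ann a b, (‖x‖ ^ 2)⁻¹ * h x := by
  have h1 : Ann a c ⊆ Ann a b := fun x hx => ⟨hx.1, hx.2.trans hcb⟩
  have h2 : Ann c b ⊆ Ann a b := fun x hx => ⟨hac.trans hx.1, hx.2⟩
  have hcont : ContinuousOn (fun q : ℝ × sphere (0 : E3) 1 => h (q.1 • (q.2 : E3)))
      (Icc a b ×ˢ univ) :=
    hh.comp (by fun_prop) fun q hq => smul_sphere_mem_Ann ha hq.1 q.2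
  rw [integral_ann' ha hac (hh.mono h1), integral_ann' (ha.trans_le hac) hcb (hh.mono h2),
    integral_ann' ha (hac.trans hcb) hh]
  exact intervalIntegral.integral_add_adjacent_intervals
    (intervalIntegrable_unitSurf hac (hcont.mono (prod_mono (Icc_subset_Icc_right hcb) le_rfl)))
    (intervalIntegrable_unitSurf hcb (hcont.mono (prod_mono (Icc_subset_Icc_left hac) le_rfl)))

end annuli

section region

variable {R T s : ℝ}

/-- The part of the triangle-shaped region up to time `s`. -/
def Kup (R T s : ℝ) : Set (E3 × ℝ) := Kreg R T ((R + T) / 2) ∩ {p : E3 × ℝ | p.2 ≤ s}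

lemma mem_Kup {x : E3} {t : ℝ} : (x, t) ∈ Kup R T s ↔
    R ≤ ‖x‖ ∧ ‖x‖ ≤ t ∧ t ≤ R + T - ‖x‖ ∧ t ≤ s := by
  simp only [Kup, Kreg, mem_inter_iff, mem_ofPred_eq]
  constructor
  · rintro ⟨⟨h1, h2, h3, h4⟩, h5⟩; exact ⟨h1, h3, h4, h5⟩
  · rintro ⟨h1, h3, h4, h5⟩; exact ⟨⟨h1, by linarith, h3, h4⟩, h5⟩

lemma isCompact_Kup : IsCompact (Kup R T s) := by
  have hcl : IsClosed (Kup R T s) := by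
    have : Kup R T s = {p | R ≤ ‖p.1‖} ∩ {p | ‖p.1‖ ≤ p.2} ∩ {p | p.2 ≤ R + T - ‖p.1‖} ∩
        {p | p.2 ≤ s} := by
      ext ⟨x, t⟩
      simp only [mem_Kup, mem_inter_iff, mem_ofPred_eq]
      tauto
    rw [this]
    refine ((IsClosed.inter ?_ ?_).inter ?_).inter ?_ <;>
      exact isClosed_le (by fun_prop) (by fun_prop)
  refine ((isCompact_closedBall (0 : E3) s).prod (isCompact_Icc (a := R) (b := s))).of_isClosed_subset
    hcl ?_
  rintro ⟨x, t⟩ hp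
  obtain ⟨h1, h2, h3, h4⟩ := mem_Kup.1 hp
  exact ⟨by simpa using h2.trans h4, h1.trans h2, h4⟩

variable {w : E3 × ℝ → ℝ} {S : Set (E3 × ℝ)}

lemma integrableOn_Kup (h0 : ∀ p ∈ S, p.1 ≠ 0) (hK : Kup R T s ⊆ S) {f : E3 × ℝ → ℝ}
    (hf : ContinuousOn f S) :
    IntegrableOn (fun p : E3 × ℝ => (‖p.1‖ ^ 2)⁻¹ * f p) (Kup R T s) :=
  (((continuousOn_inv_norm_sq h0).mul hf).mono hK).integrableOn_compact isCompact_Kup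

lemma integral_Kup_eDot (hS : IsOpen S) (h0 : ∀ p ∈ S, p.1 ≠ 0) (hw : ContDiffOn ℝ 2 w S)
    (hK : Kup R T s ⊆ S) :
    ∫ p in Kup R T s, (‖p.1‖ ^ 2)⁻¹ * eDot w p =
      ∫ x in Ann R (min s ((R + T) / 2)),
        (‖x‖ ^ 2)⁻¹ * (eDen w (x, min s (R + T - ‖x‖)) - eDen w (x, ‖x‖)) := by
  have hc := continuousOn_eDot hS h0 hw
  rw [Measure.volume_eq_prod, setIntegral_eq_integral_sections isCompact_Kup.measurableSet
    (integrableOn_Kup h0 hK hc), ← integral_indicator (measurableSet_Ann _ _)]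
  refine integral_congr_ae (Filter.Eventually.of_forall fun x => ?_)
  simp only
  by_cases hx : x ∈ Ann R (min s ((R + T) / 2))
  · have hle : ‖x‖ ≤ min s (R + T - ‖x‖) := by
      have h1 := le_min_iff.1 hx.2
      exact le_min h1.1 (by linarith)
    have hmem : ∀ t ∈ Icc ‖x‖ (min s (R + T - ‖x‖)), (x, t) ∈ Kup R T s := fun t ht =>
      mem_Kup.2 ⟨hx.1, ht.1, ht.2.trans (min_le_right _ _), ht.2.trans (min_le_left _ _)⟩
    have hsec : {t | (x, t) ∈ Kup R T s} = Icc ‖x‖ (min s (R + T - ‖x‖)) := by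
      ext t
      refine ⟨fun ht => ?_, hmem t⟩
      obtain ⟨-, h2, h3, h4⟩ := mem_Kup.1 ht
      exact ⟨h2, le_min h4 h3⟩
    rw [indicator_of_mem hx, hsec, integral_Icc_eq_integral_Ioc,
      ← intervalIntegral.integral_of_le hle, intervalIntegral.integral_const_mul]
    congr 1
    refine intervalIntegral.integral_eq_sub_of_hasDerivAt (f := fun t => eDen w (x, t)) ?_ ?_
    · rw [uIcc_of_le hle]
      exact fun t ht => hasDerivAt_eDen hS h0 hw (hK (hmem t ht))
    · refine ContinuousOn.intervalIntegrable ?_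
      rw [uIcc_of_le hle]
      exact hc.comp (f := fun t => (x, t)) (by fun_prop) fun t ht => hK (hmem t ht)
  · have hsec : {t | (x, t) ∈ Kup R T s} = ∅ := by
      ext t
      refine ⟨fun ht => hx ?_, fun h => h.elim⟩
      obtain ⟨h1, h2, h3, h4⟩ := mem_Kup.1 ht
      exact ⟨h1, le_min (h2.trans h4) (by linarith)⟩
    rw [indicator_of_notMem hx, hsec]
    simp

lemma integral_Kup_gDot (hR : 0 < R) (hRs : R ≤ s) (hsT : s ≤ T) (hS : IsOpen S)
    (h0 : ∀ p ∈ S, p.1 ≠ 0) (hw : ContDiffOn ℝ 2 w S) (hK : Kup R T s ⊆ S) :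
    ∫ p in Kup R T s, (‖p.1‖ ^ 2)⁻¹ * gDot w p =
      (∫ t in R..s, ∫ n : sphere (0 : E3) 1, gFlux w (min t (R + T - t) • (n : E3), t) ∂unitSurf)
        - ∫ t in R..s, ∫ n : sphere (0 : E3) 1, gFlux w (R • (n : E3), t) ∂unitSurf := by
  have hc := continuousOn_gDot hS h0 hw
  have hgc := continuousOn_gFlux hS h0 hw
  have hmin : ∀ t ∈ Icc R s, R ≤ min t (R + T - t) := fun t ht =>
    le_min ht.1 (by linarith [ht.2])
  have hmem : ∀ t ∈ Icc R s, ∀ r ∈ Icc R (min t (R + T - t)), ∀ n : sphere (0 : E3) 1,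
      (r • (n : E3), t) ∈ Kup R T s := by
    intro t ht r hr n
    have h1 := le_min_iff.1 hr.2
    rw [mem_Kup, norm_smul_sphere n (hR.le.trans hr.1)]
    exact ⟨hr.1, h1.1, by linarith, ht.2⟩
  have hfi1 : IntervalIntegrable (fun t => ∫ n : sphere (0 : E3) 1,
      gFlux w (min t (R + T - t) • (n : E3), t) ∂unitSurf) volume R s :=
    intervalIntegrable_unitSurf hRs (h := fun q => gFlux w (min q.1 (R + T - q.1) • (q.2 : E3), q.1))
      (hgc.comp (by fun_prop) fun q hq => hK (hmem q.1 hq.1 _ ⟨hmin _ hq.1, le_rfl⟩ q.2))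
  have hfi2 : IntervalIntegrable (fun t => ∫ n : sphere (0 : E3) 1,
      gFlux w (R • (n : E3), t) ∂unitSurf) volume R s :=
    intervalIntegrable_unitSurf hRs (h := fun q => gFlux w (R • (q.2 : E3), q.1))
      (hgc.comp (by fun_prop) fun q hq => hK (hmem q.1 hq.1 _ ⟨le_rfl, hmin _ hq.1⟩ q.2))
  rw [← intervalIntegral.integral_sub hfi1 hfi2, Measure.volume_eq_prod,
    setIntegral_eq_integral_sections_symm isCompact_Kup.measurableSet
    (integrableOn_Kup h0 hK hc), intervalIntegral.integral_of_le hRs,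
    ← integral_Icc_eq_integral_Ioc, ← integral_indicator measurableSet_Icc]
  refine integral_congr_ae (Filter.Eventually.of_forall fun t => ?_)
  simp only
  by_cases ht : t ∈ Icc R s
  · have hsec : {x | (x, t) ∈ Kup R T s} = Ann R (min t (R + T - t)) := by
      ext x
      simp only [mem_ofPred_eq, mem_Kup, Ann, le_min_iff]
      constructor
      · rintro ⟨h1, h2, h3, -⟩; exact ⟨h1, h2, by linarith⟩
      · rintro ⟨h1, h2, h3⟩; exact ⟨h1, h2, by linarith, ht.2⟩
    rw [indicator_of_mem ht, hsec]
    rw [integral_ann hR (hmin t ht) (h := fun x => gDot w (x, t)), ← integral_sub]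
    · refine integral_congr_ae (Filter.Eventually.of_forall fun n => ?_)
      refine intervalIntegral.integral_eq_sub_of_hasDerivAt
        (f := fun r => gFlux w (r • (n : E3), t)) ?_ ?_
      · rw [uIcc_of_le (hmin t ht)]
        exact fun r hr => hasDerivAt_gFlux hS h0 hw (norm_eq_of_mem_sphere n)
          (hR.trans_le hr.1) (hK (hmem t ht r hr n))
      · refine ContinuousOn.intervalIntegrable ?_
        rw [uIcc_of_le (hmin t ht)]
        exact hc.comp (f := fun r : ℝ => (r • (n : E3), t)) (by fun_prop)
          fun r hr => hK (hmem t ht r hr n)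
    · refine Continuous.integrable_of_hasCompactSupport (continuousOn_univ.1 ?_)
        (HasCompactSupport.of_compactSpace _)
      exact hgc.comp (by fun_prop) fun n _ => hK (hmem t ht _ ⟨hmin t ht, le_rfl⟩ n)
    · refine Continuous.integrable_of_hasCompactSupport (continuousOn_univ.1 ?_)
        (HasCompactSupport.of_compactSpace _)
      exact hgc.comp (by fun_prop) fun n _ => hK (hmem t ht _ ⟨le_rfl, hmin t ht⟩ n)
    · refine hc.comp (by fun_prop) fun x hx => hK ?_
      rw [← hsec] at hx
      exact hx
  · have hsec : {x | (x, t) ∈ Kup R T s} = ∅ := by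
      ext x
      refine ⟨fun hx => ht ?_, fun h => h.elim⟩
      obtain ⟨h1, h2, h3, h4⟩ := mem_Kup.1 hx
      exact ⟨h1.trans h2, h4⟩
    rw [indicator_of_notMem ht, hsec]
    simp

lemma two_mul_integral_Kup (hS : IsOpen S)
    (h0 : ∀ p ∈ S, p.1 ≠ 0) (hw : ContDiffOn ℝ 2 w S) (hK : Kup R T s ⊆ S) :
    2 * ∫ p in Kup R T s, (‖p.1‖ ^ 2)⁻¹ * pdt w p * (Fop w p + w p) =
      (∫ p in Kup R T s, (‖p.1‖ ^ 2)⁻¹ * eDot w p)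
        - ∫ p in Kup R T s, (‖p.1‖ ^ 2)⁻¹ * gDot w p := by
  have hrot : ∀ x y : E3, ∀ t : ℝ, ‖x‖ = ‖y‖ → (x, t) ∈ Kup R T s → (y, t) ∈ Kup R T s := by
    intro x y t hxy h
    rw [mem_Kup] at h ⊢
    rwa [← hxy]
  have hprod : ∀ i j, ContDiffOn ℝ 1 (fun q => pdt w q * angX i j w q) S := fun i j =>
    (contDiffOn_pdt hS hw (by norm_num)).mul (contDiffOn_angX hS hw (by norm_num) i j)
  have hang : ∀ i j, IntegrableOn (fun p : E3 × ℝ => (‖p.1‖ ^ 4)⁻¹ *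
      angX i j (fun q => pdt w q * angX i j w q) p) (Kup R T s) := by
    intro i j
    refine ContinuousOn.integrableOn_compact isCompact_Kup (ContinuousOn.mono (ContinuousOn.mul ?_
      (contDiffOn_angX (m := 0) hS (hprod i j) (by norm_num) i j).continuousOn) hK)
    exact ContinuousOn.inv₀ (by fun_prop) fun p hp => pow_ne_zero 4 (norm_ne_zero_iff.2 (h0 p hp))
  have hzero := fun (i j : Fin 3) (hij : i < j) => setIntegral_angX_eq_zero isCompact_Kup hS hK hrot
    (fun p hp => h0 p (hK hp)) (hprod i j) hij
  have he := integrableOn_Kup h0 hK (continuousOn_eDot hS h0 hw)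
  have hg := integrableOn_Kup h0 hK (continuousOn_gDot hS h0 hw)
  have hsum12 := (hang 0 1).fun_add (hang 0 2)
  have hsum := hsum12.fun_add (hang 1 2)
  calc 2 * ∫ p in Kup R T s, (‖p.1‖ ^ 2)⁻¹ * pdt w p * (Fop w p + w p)
      = ∫ p in Kup R T s, ((‖p.1‖ ^ 2)⁻¹ * eDot w p - (‖p.1‖ ^ 2)⁻¹ * gDot w p)
        - 2 * ((‖p.1‖ ^ 4)⁻¹ * angX 0 1 (fun q => pdt w q * angX 0 1 w q) p
          + (‖p.1‖ ^ 4)⁻¹ * angX 0 2 (fun q => pdt w q * angX 0 2 w q) p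
          + (‖p.1‖ ^ 4)⁻¹ * angX 1 2 (fun q => pdt w q * angX 1 2 w q) p) := by
        rw [← integral_const_mul]
        refine setIntegral_congr_fun isCompact_Kup.measurableSet fun p hp => ?_
        have h := two_mul_pdt_mul_Fop hS hw (hK hp)
        have h4 : (‖p.1‖ ^ 4)⁻¹ = (‖p.1‖ ^ 2)⁻¹ * (‖p.1‖ ^ 2)⁻¹ := by
          rw [← mul_inv, ← pow_add]
        simp only [h4]
        linear_combination (‖p.1‖ ^ 2)⁻¹ * h
    _ = _ := by
        rw [integral_sub (he.fun_sub hg) (hsum.const_mul 2), integral_const_mul,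
          integral_add hsum12 (hang 1 2),
          integral_add (hang 0 1) (hang 0 2), hzero 0 1 (by decide), hzero 0 2 (by decide),
          hzero 1 2 (by decide), integral_sub he hg]
        ring

end region

section boundary

variable {R T s : ℝ} {w : E3 × ℝ → ℝ} {S : Set (E3 × ℝ)}

lemma mem_Kreg_iff {x : E3} {t : ℝ} : (x, t) ∈ Kreg R T ((R + T) / 2) ↔
    R ≤ ‖x‖ ∧ ‖x‖ ≤ t ∧ t ≤ R + T - ‖x‖ := by
  simp only [Kreg, mem_ofPred_eq]
  constructor
  · rintro ⟨h1, h2, h3, h4⟩; exact ⟨h1, h3, h4⟩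
  · rintro ⟨h1, h3, h4⟩; exact ⟨h1, by linarith, h3, h4⟩

lemma integral_gFlux_lower {a b : ℝ} (ha : 0 < a) (hab : a ≤ b)
    (hg : ContinuousOn (fun x => gFlux w (x, ‖x‖)) (Ann a b)) :
    ∫ t in a..b, ∫ n : sphere (0 : E3) 1, gFlux w (t • (n : E3), t) ∂unitSurf =
      ∫ x in Ann a b, (‖x‖ ^ 2)⁻¹ * gFlux w (x, ‖x‖) := by
  rw [integral_ann' ha hab hg]
  refine intervalIntegral.integral_congr fun t ht => ?_
  rw [uIcc_of_le hab] at ht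
  simp only [norm_smul_sphere _ (ha.le.trans ht.1)]

lemma integral_gFlux_upper {a b d : ℝ} (ha : 0 < a) (hab : a ≤ b)
    (hg : ContinuousOn (fun x => gFlux w (x, d - ‖x‖)) (Ann a b)) :
    ∫ t in (d - b)..(d - a), ∫ n : sphere (0 : E3) 1, gFlux w ((d - t) • (n : E3), t) ∂unitSurf =
      ∫ x in Ann a b, (‖x‖ ^ 2)⁻¹ * gFlux w (x, d - ‖x‖) := by
  rw [integral_ann' ha hab hg, ← intervalIntegral.integral_comp_sub_left
    (fun t => ∫ n : sphere (0 : E3) 1, gFlux w ((d - t) • (n : E3), t) ∂unitSurf)]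
  refine intervalIntegral.integral_congr fun t ht => ?_
  rw [uIcc_of_le hab] at ht
  simp only [norm_smul_sphere _ (ha.le.trans ht.1), sub_sub_cancel]

lemma neg_integral_gFlux_le (hR : 0 < R) (hRT : R < T) (hRs : R ≤ s) (hsT : s ≤ T)
    (hS : IsOpen S) (h0 : ∀ p ∈ S, p.1 ≠ 0) (hw : ContDiffOn ℝ 2 w S)
    (hK : Kreg R T ((R + T) / 2) ⊆ S) :
    -(∫ t in R..s, ∫ n : sphere (0 : E3) 1, gFlux w (R • (n : E3), t) ∂unitSurf) ≤
      ∫ t in R..T, sphInt R (fun x =>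
        (R ^ 2)⁻¹ * ((pdt w (x, t)) ^ 2 + (pdrX w (x, t)) ^ 2)) := by
  have hgc := continuousOn_gFlux hS h0 hw
  have ht := (contDiffOn_pdt (m := 1) hS hw (by norm_num)).continuousOn
  have hr := (contDiffOn_pdrX (m := 1) hS h0 hw (by norm_num)).continuousOn
  have hmem : ∀ t ∈ Icc R T, ∀ x ∈ sphere (0 : E3) R, (x, t) ∈ S := by
    intro t ht x hx
    refine hK (mem_Kreg_iff.2 ?_)
    rw [mem_sphere_zero_iff_norm.1 hx]
    exact ⟨le_rfl, ht.1, by linarith [ht.2]⟩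
  have hsm : ∀ n : sphere (0 : E3) 1, R • (n : E3) ∈ sphere (0 : E3) R := fun n => by
    rw [mem_sphere_zero_iff_norm, norm_smul_sphere n hR.le]
  set q : E3 × ℝ → ℝ := fun p => (R ^ 2)⁻¹ * (pdt w p ^ 2 + pdrX w p ^ 2) with hq
  have hqc : ContinuousOn q S := continuousOn_const.mul ((ht.pow 2).add (hr.pow 2))
  have hq0 : ∀ p, 0 ≤ q p := fun p => by positivity
  have : IsFiniteMeasure ((μH[2] : Measure E3).restrict (sphere 0 R)) :=
    isFiniteMeasure_restrict.2 (hausdorffMeasure_sphere_lt_top hR).ne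
  have hqi : IntervalIntegrable (fun t => sphInt R fun x => q (x, t)) volume R T := by
    have h := intervalIntegrable_integral_of_continuousOn
      (μ := (μH[2] : Measure E3).restrict (sphere 0 R)) (isCompact_sphere (0 : E3) R) hRT.le
      (h := fun z => q (z.2, z.1))
      (hqc.comp (by fun_prop) fun z hz => hmem z.1 hz.1 z.2 hz.2)
    simpa only [Measure.restrict_restrict isClosed_sphere.measurableSet, inter_self, sphInt] using h
  have hqs : IntervalIntegrable (fun t => sphInt R fun x => q (x, t)) volume R s :=
    hqi.mono_set (by rw [uIcc_of_le hRs, uIcc_of_le hRT.le]; exact Icc_subset_Icc_right hsT)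
  have hgi : IntervalIntegrable (fun t => ∫ n : sphere (0 : E3) 1,
      gFlux w (R • (n : E3), t) ∂unitSurf) volume R s :=
    intervalIntegrable_unitSurf hRs (h := fun z => gFlux w (R • (z.2 : E3), z.1))
      (hgc.comp (by fun_prop) fun z hz => hmem z.1 ⟨hz.1.1, hz.1.2.trans hsT⟩ _ (hsm z.2))
  have hpt : ∀ t ∈ Icc R s, -(∫ n : sphere (0 : E3) 1, gFlux w (R • (n : E3), t) ∂unitSurf) ≤
      sphInt R fun x => q (x, t) := by
    intro t ht
    have ht' : t ∈ Icc R T := ⟨ht.1, ht.2.trans hsT⟩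
    have hcomp : ∀ {f : E3 × ℝ → ℝ}, ContinuousOn f S →
        Integrable (fun n : sphere (0 : E3) 1 => f (R • (n : E3), t)) unitSurf := by
      intro f hf
      refine Continuous.integrable_of_hasCompactSupport (continuousOn_univ.1 ?_)
        (HasCompactSupport.of_compactSpace _)
      exact hf.comp (by fun_prop) fun n _ => hmem t ht' _ (hsm n)
    refine le_trans ?_ (integral_unitSurf_le_sphInt hR (q := fun x => q (x, t))
      (hqc.comp (by fun_prop) fun x hx => hmem t ht' x hx) fun x _ => hq0 _)
    rw [← integral_neg, ← integral_const_mul]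
    refine integral_mono (hcomp hgc).neg ((hcomp hqc).const_mul _) fun n => ?_
    simp only [gFlux, hq]
    rw [mul_inv_cancel_left₀ (by positivity)]
    nlinarith [sq_nonneg (pdt w (R • (n : E3), t) + pdrX w (R • (n : E3), t))]
  have hnn : ∀ t, 0 ≤ sphInt R fun x => q (x, t) := fun t =>
    integral_nonneg fun x => hq0 _
  rw [← intervalIntegral.integral_neg]
  refine (intervalIntegral.integral_mono_on hRs hgi.neg hqs hpt).trans ?_
  exact intervalIntegral.integral_mono_interval le_rfl hRs hsT
    (Filter.Eventually.of_forall hnn) hqi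

lemma integral_ann_congr {a b : ℝ} {f g : E3 → ℝ} (h : ∀ x ∈ Ann a b, f x = g x) :
    ∫ x in Ann a b, (‖x‖ ^ 2)⁻¹ * f x = ∫ x in Ann a b, (‖x‖ ^ 2)⁻¹ * g x :=
  setIntegral_congr_fun (measurableSet_Ann a b) fun x hx => by simp only [h x hx]

lemma integral_ann_sub {a b : ℝ} (ha : 0 < a) {f g : E3 → ℝ} (hf : ContinuousOn f (Ann a b))
    (hg : ContinuousOn g (Ann a b)) :
    ∫ x in Ann a b, (‖x‖ ^ 2)⁻¹ * (f x - g x) =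
      (∫ x in Ann a b, (‖x‖ ^ 2)⁻¹ * f x) - ∫ x in Ann a b, (‖x‖ ^ 2)⁻¹ * g x := by
  rw [← integral_sub (integrable_ann ha hf) (integrable_ann ha hg)]
  simp only [mul_sub]

lemma integral_ann_add {a b : ℝ} (ha : 0 < a) {f g : E3 → ℝ} (hf : ContinuousOn f (Ann a b))
    (hg : ContinuousOn g (Ann a b)) :
    ∫ x in Ann a b, (‖x‖ ^ 2)⁻¹ * (f x + g x) =
      (∫ x in Ann a b, (‖x‖ ^ 2)⁻¹ * f x) + ∫ x in Ann a b, (‖x‖ ^ 2)⁻¹ * g x := by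
  rw [← integral_add (integrable_ann ha hf) (integrable_ann ha hg)]
  simp only [mul_add]

theorem energy_estimate (hR : 0 < R) (hRT : R < T) (hRs : R ≤ s) (hsT : s ≤ T)
    (hS : IsOpen S) (h0 : ∀ p ∈ S, p.1 ≠ 0) (hw : ContDiffOn ℝ 2 w S)
    (hK : Kreg R T ((R + T) / 2) ⊆ S) :
    (∫ x in Ann R (min s (R + T - s)), (‖x‖ ^ 2)⁻¹ * eDen w (x, s))
      + (if (R + T) / 2 ≤ s then
          ∫ x in Ann (R + T - s) ((R + T) / 2), (‖x‖ ^ 2)⁻¹ *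
            ((w (x, R + T - ‖x‖)) ^ 2 + gradsq (fun y => w (y, R + T - ‖y‖)) x)
         else 0)
      ≤ (∫ x in Ann R ((R + T) / 2), (‖x‖ ^ 2)⁻¹ *
            ((w (x, ‖x‖)) ^ 2 + gradsq (fun y => w (y, ‖y‖)) x))
        + 2 * (∫ p in Kup R T s, (‖p.1‖ ^ 2)⁻¹ * pdt w p * (Fop w p + w p))
        + ∫ t in R..T, sphInt R (fun x =>
            (R ^ 2)⁻¹ * ((pdt w (x, t)) ^ 2 + (pdrX w (x, t)) ^ 2)) := by
  have hKs : Kup R T s ⊆ S := inter_subset_left.trans hK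
  have hgc := continuousOn_gFlux hS h0 hw
  have hec := continuousOn_eDen hS h0 hw
  set m := (R + T) / 2 with hm
  have hRm : R < m := by linarith
  have hlow : ∀ x ∈ Ann R m, (x, ‖x‖) ∈ S := fun x hx =>
    hK (mem_Kreg_iff.2 ⟨hx.1, le_rfl, by linarith [hx.2]⟩)
  have hupp : ∀ x ∈ Ann R m, (x, R + T - ‖x‖) ∈ S := fun x hx =>
    hK (mem_Kreg_iff.2 ⟨hx.1, by linarith [hx.2], le_rfl⟩)
  have hgl : ContinuousOn (fun x => gFlux w (x, ‖x‖)) (Ann R m) := hgc.comp (by fun_prop) hlow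
  have hel : ContinuousOn (fun x => eDen w (x, ‖x‖)) (Ann R m) := hec.comp (by fun_prop) hlow
  have hgu : ContinuousOn (fun x => gFlux w (x, R + T - ‖x‖)) (Ann R m) :=
    hgc.comp (by fun_prop) hupp
  have heu : ContinuousOn (fun x => eDen w (x, R + T - ‖x‖)) (Ann R m) :=
    hec.comp (by fun_prop) hupp
  have hlow_eq : ∀ x ∈ Ann R m, (w (x, ‖x‖)) ^ 2 + gradsq (fun y => w (y, ‖y‖)) x =
      eDen w (x, ‖x‖) + gFlux w (x, ‖x‖) := by
    intro x hx
    have h := sq_add_gradsq_cone (w := w) (x := x) (c := 0) (σ := 1) (by norm_num)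
      (h0 _ (hlow x hx)) (by
        rw [zero_add, one_mul]; exact hw.differentiableAt_of_isOpen hS (by norm_num) (hlow x hx))
    simpa only [zero_add, one_mul] using h
  have hupp_eq : ∀ x ∈ Ann R m, (w (x, R + T - ‖x‖)) ^ 2 +
      gradsq (fun y => w (y, R + T - ‖y‖)) x =
      eDen w (x, R + T - ‖x‖) - gFlux w (x, R + T - ‖x‖) := by
    intro x hx
    have h := sq_add_gradsq_cone (w := w) (x := x) (c := R + T) (σ := -1) (by norm_num)
      (h0 _ (hupp x hx)) (by
        rw [neg_one_mul, ← sub_eq_add_neg]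
        exact hw.differentiableAt_of_isOpen hS (by norm_num) (hupp x hx))
    simpa only [neg_one_mul, ← sub_eq_add_neg] using h
  have hside := neg_integral_gFlux_le hR hRT hRs hsT hS h0 hw hK
  have hmain := two_mul_integral_Kup hS h0 hw hKs
  rw [integral_Kup_eDot hS h0 hw hKs, integral_Kup_gDot hR hRs hsT hS h0 hw hKs, ← hm] at hmain
  have htop : ∀ x ∈ Ann R (min s m), (x, min s (R + T - ‖x‖)) ∈ S := fun x hx => by
    have h1 := le_min_iff.1 hx.2
    exact hK (mem_Kreg_iff.2 ⟨hx.1, le_min h1.1 (by linarith), min_le_right _ _⟩)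
  have hsub : Ann R (min s m) ⊆ Ann R m := fun x hx => ⟨hx.1, hx.2.trans (min_le_right _ _)⟩
  have het : ContinuousOn (fun x => eDen w (x, min s (R + T - ‖x‖))) (Ann R (min s m)) :=
    hec.comp (by fun_prop) htop
  rw [integral_ann_sub hR het (hel.mono hsub)] at hmain
  rcases lt_or_ge s m with hsm | hsm
  · rw [min_eq_left hsm.le] at hmain hsub
    have h1 : ∫ t in R..s, ∫ n : sphere (0 : E3) 1,
        gFlux w (min t (R + T - t) • (n : E3), t) ∂unitSurf =
        ∫ x in Ann R s, (‖x‖ ^ 2)⁻¹ * gFlux w (x, ‖x‖) := by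
      rw [← integral_gFlux_lower hR hRs (hgl.mono hsub)]
      refine intervalIntegral.integral_congr fun t ht => ?_
      rw [uIcc_of_le hRs] at ht
      simp only [min_eq_left (show t ≤ R + T - t by linarith [ht.2])]
    have h2 := integral_ann_congr (a := R) (b := s)
      (f := fun x => eDen w (x, min s (R + T - ‖x‖))) (g := fun x => eDen w (x, s)) fun x hx => by
        rw [min_eq_left (show s ≤ R + T - ‖x‖ by linarith [hx.2])]
    have h3 : 0 ≤ ∫ x in Ann s m, (‖x‖ ^ 2)⁻¹ * (eDen w (x, ‖x‖) + gFlux w (x, ‖x‖)) := by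
      refine setIntegral_nonneg (measurableSet_Ann s m) fun x hx => ?_
      rw [← hlow_eq x ⟨hRs.trans hx.1, hx.2⟩, gradsq]
      positivity
    rw [if_neg (not_le.2 hsm), min_eq_left (show s ≤ R + T - s by linarith),
      integral_ann_congr hlow_eq, ← integral_ann_add_ann hR hRs hsm.le (hel.fun_add hgl),
      integral_ann_add hR (hel.mono hsub) (hgl.mono hsub)]
    linarith
  · rw [min_eq_right hsm] at hmain htop het
    set c := R + T - s with hc
    have hRc : R ≤ c := by linarith
    have hcm : c ≤ m := by linarith
    have hsub1 : Ann R c ⊆ Ann R m := fun x hx => ⟨hx.1, hx.2.trans hcm⟩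
    have hsub2 : Ann c m ⊆ Ann R m := fun x hx => ⟨hRc.trans hx.1, hx.2⟩
    have hgi : IntervalIntegrable (fun t => ∫ n : sphere (0 : E3) 1,
        gFlux w (min t (R + T - t) • (n : E3), t) ∂unitSurf) volume R s := by
      refine intervalIntegrable_unitSurf hRs
        (h := fun q => gFlux w (min q.1 (R + T - q.1) • (q.2 : E3), q.1))
        (hgc.comp (by fun_prop) fun q hq => hK (mem_Kreg_iff.2 ?_))
      have h1 : R ≤ min q.1 (R + T - q.1) := le_min hq.1.1 (by linarith [hq.1.2])
      rw [norm_smul_sphere _ (hR.le.trans h1)]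
      exact ⟨h1, min_le_left _ _, by linarith [min_le_right q.1 (R + T - q.1)]⟩
    have h1 : ∫ t in R..m, ∫ n : sphere (0 : E3) 1,
        gFlux w (min t (R + T - t) • (n : E3), t) ∂unitSurf =
        ∫ x in Ann R m, (‖x‖ ^ 2)⁻¹ * gFlux w (x, ‖x‖) := by
      rw [← integral_gFlux_lower hR hRm.le hgl]
      refine intervalIntegral.integral_congr fun t ht => ?_
      rw [uIcc_of_le hRm.le] at ht
      simp only [min_eq_left (show t ≤ R + T - t by linarith [ht.2])]
    have h2 : ∫ t in m..s, ∫ n : sphere (0 : E3) 1,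
        gFlux w (min t (R + T - t) • (n : E3), t) ∂unitSurf =
        ∫ x in Ann c m, (‖x‖ ^ 2)⁻¹ * gFlux w (x, R + T - ‖x‖) := by
      rw [← integral_gFlux_upper (hR.trans_le hRc) hcm (hgu.mono hsub2),
        show R + T - m = m by linarith, show R + T - c = s by linarith]
      refine intervalIntegral.integral_congr fun t ht => ?_
      rw [uIcc_of_le hsm] at ht
      simp only [min_eq_right (show R + T - t ≤ t by linarith [ht.1])]
    have h12 := intervalIntegral.integral_add_adjacent_intervals
      (hgi.mono_set (c := R) (d := m) (by
        rw [uIcc_of_le hRs, uIcc_of_le hRm.le]; exact Icc_subset_Icc_right hsm))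
      (hgi.mono_set (c := m) (d := s) (by
        rw [uIcc_of_le hRs, uIcc_of_le hsm]; exact Icc_subset_Icc_left hRm.le))
    have h3 := integral_ann_congr (a := R) (b := c)
      (f := fun x => eDen w (x, min s (R + T - ‖x‖))) (g := fun x => eDen w (x, s)) fun x hx => by
        rw [min_eq_left (show s ≤ R + T - ‖x‖ by linarith [hx.2])]
    have h4 := integral_ann_congr (a := c) (b := m)
      (f := fun x => eDen w (x, min s (R + T - ‖x‖)))
      (g := fun x => eDen w (x, R + T - ‖x‖)) fun x hx => by
        rw [min_eq_right (show R + T - ‖x‖ ≤ s by linarith [hx.1])]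
    have h34 := integral_ann_add_ann hR hRc hcm het
    rw [if_pos hsm, min_eq_right (show c ≤ s by linarith), integral_ann_congr hlow_eq,
      integral_ann_congr (fun x hx => hupp_eq x (hsub2 hx)), integral_ann_add hR hel hgl,
      integral_ann_sub (hR.trans_le hRc) (heu.mono hsub2) (hgu.mono hsub2)]
    linarith

end boundary

/-- **estimate (2.10).** The standard energy estimate on `K`: for every
`s ∈ [R,T]` the energy `E(s)` is controlled by the data on the lower cone, the source
term, and the Cauchy data on the cylinder `|x| = R`. -/
theorem stmt14 (R T : ℝ) (hR : 0 < R) (hRT : R < T)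
    (w : E3 × ℝ → ℝ) (S : Set (E3 × ℝ)) (hS : IsOpen S)
    (hK : Kreg R T ((R + T) / 2) ⊆ S) (hw : ContDiffOn ℝ 2 w S) :
    ∀ s ∈ Icc R T,
      (∫ x in Ann R (min s (R + T - s)), (‖x‖ ^ 2)⁻¹ *
          ((w (x, s)) ^ 2 + (pdt w (x, s)) ^ 2 + gradsqX w (x, s)))
      + (if (R + T) / 2 ≤ s then
          ∫ x in Ann (R + T - s) ((R + T) / 2), (‖x‖ ^ 2)⁻¹ *
            ((w (x, R + T - ‖x‖)) ^ 2 + gradsq (fun y => w (y, R + T - ‖y‖)) x)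
         else 0)
      ≤ (∫ x in Ann R ((R + T) / 2), (‖x‖ ^ 2)⁻¹ *
            ((w (x, ‖x‖)) ^ 2 + gradsq (fun y => w (y, ‖y‖)) x))
        + 2 * (∫ p in Kreg R T ((R + T) / 2) ∩ {p : E3 × ℝ | p.2 ≤ s},
            (‖p.1‖ ^ 2)⁻¹ * pdt w p * (Fop w p + w p))
        + ∫ t in R..T, sphInt R (fun x =>
            (R ^ 2)⁻¹ * ((pdt w (x, t)) ^ 2 + (pdrX w (x, t)) ^ 2)) := by
  intro s hs
  have hS' : IsOpen (S ∩ {p : E3 × ℝ | p.1 ≠ 0}) :=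
    hS.inter (isOpen_ne_fun continuous_fst continuous_const)
  have hK' : Kreg R T ((R + T) / 2) ⊆ S ∩ {p : E3 × ℝ | p.1 ≠ 0} := fun p hp =>
    ⟨hK hp, norm_pos_iff.1 (hR.trans_le hp.1)⟩
  exact energy_estimate hR hRT hs.1 hs.2 hS' (fun p hp => hp.2) (hw.mono inter_subset_left) hK'
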